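/- arXiv:2210.12576 — 4 statements merged into one kernel-verified Lean document; each statement's English description precedes it below -/
import Mathlib

section
/- Let k, l be coprime positive integers with k > 1 and kl nonsquare, such that k x² − l y² = 1 has a positive integer solution, and let ε = x₁√k + y₁√l where (x₁, y₁) is the minimal positive solution. Let (x, y) be any positive integer solution of k x² − l y² = 1. (i) If every prime divisor of x divides k, then x√k + y√l = ε, or x√k + y√l = ε³ and there is a positive integer s with x = 3ˢ x₁, 3 ∤ x₁, and 3ˢ + 3 = 4 k x₁². (ii) If every prime divisor of y divides l, then x√k + y√l = ε, or x√k + y√l = ε³ and there is a positive integer s with y = 3ˢ y₁, 3 ∤ y₁, and 3ˢ − 3 = 4 l y₁². -/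
lemma sq_eq_one_cases (e : ℤ) (he : e ^ 2 = 1) : e = 1 ∨ e = -1 := by
  have : (e - 1) * (e + 1) = 0 := by linear_combination he
  rcases mul_eq_zero.mp this with h | h <;> omega

/-- The two cofactors of `(s + t)^(2r+1) = s * A + t * B`, with `a = s²`, `b = t²`. -/
def cof (a b : ℕ) : ℕ → ℕ × ℕ
  | 0 => (1, 1)
  | r + 1 => ((a + b) * (cof a b r).1 + 2 * b * (cof a b r).2,
      (a + b) * (cof a b r).2 + 2 * a * (cof a b r).1)

lemma cof_swap (a b r : ℕ) : (cof b a r).1 = (cof a b r).2 ∧ (cof b a r).2 = (cof a b r).1 := by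
  induction r with
  | zero => simp [cof]
  | succ r ih => simp only [cof, ih.1, ih.2, Nat.add_comm b a, and_self]

lemma cof_pow (a b : ℕ) (s t : ℝ) (hs : s ^ 2 = a) (ht : t ^ 2 = b) (r : ℕ) :
    (s + t) ^ (2 * r + 1) = s * ((cof a b r).1 : ℝ) + t * ((cof a b r).2 : ℝ) := by
  induction r with
  | zero => simp [cof]
  | succ r ih =>
    have : (s + t) ^ (2 * (r + 1) + 1) = (s + t) ^ (2 * r + 1) * (s + t) ^ 2 := by ring
    rw [this, ih]
    simp only [cof]
    push_cast
    rw [← hs, ← ht]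
    ring

lemma cof_norm (a b : ℕ) (e : ℤ) (he : e ^ 2 = 1) (h : (b : ℤ) = a + e) (r : ℕ) :
    (b : ℤ) * ((cof a b r).2 : ℤ) ^ 2 = a * ((cof a b r).1 : ℤ) ^ 2 + e := by
  induction r with
  | zero => simp [cof, h]
  | succ r ih =>
    simp only [cof]
    push_cast
    generalize ((cof a b r).1 : ℤ) = A at *
    generalize ((cof a b r).2 : ℤ) = B at *
    have h2 : ((b : ℤ) - a) ^ 2 = 1 := by rw [h]; ring_nf; exact he
    linear_combination ih + ((b:ℤ) * B ^ 2 - a * A ^ 2) * h2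

lemma cof_mod (a b : ℕ) (e : ℤ) (he : e ^ 2 = 1) (h : (b : ℤ) = a + e) (r : ℕ) :
    (∃ P : ℤ, ((cof a b r).1 : ℤ) = (2 * r + 1) * e ^ r + a * P) ∧
    ∃ Q : ℤ, ((cof a b r).2 : ℤ) = e ^ r + a * Q := by
  induction r with
  | zero => exact ⟨⟨0, by simp [cof]⟩, ⟨0, by simp [cof]⟩⟩
  | succ r ih =>
    obtain ⟨⟨P, hP⟩, ⟨Q, hQ⟩⟩ := ih
    simp only [cof]
    push_cast
    rw [hP, hQ, h]
    refine ⟨⟨2 * ((2 * r + 1) * e ^ r + a * P) + e * P + 2 * (e ^ r + a * Q) + 2 * e * Q, by ring⟩,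
      ⟨2 * (e ^ r + a * Q) + e * Q + 2 * ((2 * r + 1) * e ^ r + a * P), by ring⟩⟩

lemma cof_mod2 (a b : ℕ) (e : ℤ) (he : e ^ 2 = 1) (h : (b : ℤ) = a + e) (r : ℕ) :
    (∃ P : ℤ, 3 * ((cof a b r).1 : ℤ) =
      (2 * r + 1) * e ^ r * (3 + 2 * r * (r + 1) * e * a) + a ^ 2 * P) ∧
    ∃ Q : ℤ, ((cof a b r).2 : ℤ) = e ^ r * (1 + 2 * r * (r + 1) * e * a) + a ^ 2 * Q := by
  induction r with
  | zero => exact ⟨⟨0, by simp [cof]⟩, ⟨0, by simp [cof]⟩⟩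
  | succ r ih =>
    obtain ⟨⟨P, hP⟩, ⟨Q, hQ⟩⟩ := ih
    simp only [cof]
    push_cast
    have e1 : e * e = 1 := by rw [← he]; ring
    constructor
    · refine ⟨2 * ((2 * r + 1) * e ^ r * (2 * r * (r + 1) * e)) + (2 * a + e) * P
        + 6 * (e ^ r * (2 * r * (r + 1) * e)) + 6 * (a + e) * Q, ?_⟩
      rw [hQ, h]
      linear_combination (2 * (a:ℤ) + e) * hP +
        ((2 * r + 1) * 2 * r * (r + 1) * a * e ^ r + 12 * r * (r + 1) * a * e ^ r
          - (2 * r + 3) * 2 * (r + 1) * (r + 2) * a * e ^ r) * e1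
    · obtain ⟨⟨P', hP'⟩, -⟩ := cof_mod a b e he h r
      refine ⟨2 * (e ^ r * (2 * r * (r + 1) * e)) + (2 * a + e) * Q + 2 * P', ?_⟩
      rw [hQ, h, hP']
      linear_combination (2 * r * (r + 1) * a * e ^ r
          - 2 * (r + 1) * (r + 2) * a * e ^ r) * e1

lemma cof_size (a b : ℕ) (hab : 3 ≤ a + b) (hb : 1 ≤ b) (r : ℕ) :
    1 ≤ (cof a b r).2 ∧ 2 * r + 1 ≤ (cof a b r).1 ∧ (1 ≤ r → 2 * r + 1 < (cof a b r).1) := by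
  induction r with
  | zero => simp [cof]
  | succ r ih =>
    obtain ⟨h1, h2, -⟩ := ih
    simp only [cof]
    have i1 : 3 * (cof a b r).1 ≤ (a + b) * (cof a b r).1 := Nat.mul_le_mul_right _ hab
    have i2 : 3 * (cof a b r).2 ≤ (a + b) * (cof a b r).2 := Nat.mul_le_mul_right _ hab
    have i3 : 1 * (cof a b r).2 ≤ b * (cof a b r).2 := Nat.mul_le_mul_right _ hb
    have i4 : 0 ≤ a * (cof a b r).1 := Nat.zero_le _
    have i5 : 2 * b * (cof a b r).2 = 2 * (b * (cof a b r).2) := by ring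
    refine ⟨by omega, by omega, fun _ => by omega⟩

lemma cof_prime (a b : ℕ) (e : ℤ) (he : e ^ 2 = 1) (h : (b : ℤ) = a + e) (ha : 1 ≤ a)
    (hb : 1 ≤ b) (r : ℕ) (hp : (2 * r + 1).Prime)
    (hq : ∀ q : ℕ, q.Prime → q ∣ (cof a b r).1 → q ∣ a) :
    r = 1 ∧ ∃ s, 2 ≤ s ∧ (cof a b r).1 = 3 ^ s := by
  have hr : 1 ≤ r := by
    rcases Nat.eq_zero_or_pos r with h0 | h0
    · subst h0; exact absurd hp (by norm_num)
    · exact h0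
  have hab : 3 ≤ a + b := by
    rcases sq_eq_one_cases e he with h0 | h0 <;> omega
  obtain ⟨-, -, hbig⟩ := cof_size a b hab hb r
  have hbig := hbig hr
  obtain ⟨⟨P, hP⟩, -⟩ := cof_mod a b e he h r
  obtain ⟨⟨P2, hP2⟩, -⟩ := cof_mod2 a b e he h r
  have heu : IsUnit e := by
    rcases sq_eq_one_cases e he with h0 | h0 <;> simp [h0]
  have heu : IsUnit (e ^ r) := heu.pow r
  have huniq : ∀ q : ℕ, q.Prime → q ∣ (cof a b r).1 → q = 2 * r + 1 := by
    intro q hqp hqd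
    have h1 := hq q hqp hqd
    have h2 : (q : ℤ) ∣ (2 * r + 1) * e ^ r := by
      have : ((2 * r + 1) * e ^ r : ℤ) = (cof a b r).1 - a * P := by rw [hP]; ring
      rw [this]
      exact dvd_sub (by exact_mod_cast hqd) (Dvd.dvd.mul_right (by exact_mod_cast h1) _)
    rw [heu.dvd_mul_right] at h2
    exact (Nat.prime_dvd_prime_iff_eq hqp hp).mp (by exact_mod_cast h2)
  have hpow := Nat.eq_prime_pow_of_unique_prime_dvd (n := (cof a b r).1) (p := 2 * r + 1)
    (by omega) (fun {d} hd hdd => huniq d hd hdd)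
  set s := (cof a b r).1.primeFactorsList.length with hs
  clear_value s
  have hs2 : 2 ≤ s := by
    by_contra hlt
    interval_cases s <;> simp at hpow <;> omega
  have hpA : (2 * r + 1) ^ 2 ∣ (cof a b r).1 := by
    rw [hpow]; exact pow_dvd_pow _ hs2
  have hpa : (2 * r + 1) ∣ a := hq _ hp ((dvd_pow_self _ two_ne_zero).trans hpA)
  have h3 : (((2 * r + 1 : ℕ) : ℤ)) ∣ 3 := by
    obtain ⟨c, hc⟩ := hpa
    obtain ⟨d, hd⟩ := hpA
    have hac : (a : ℤ) = (2 * r + 1) * c := by exact_mod_cast hc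
    have had : ((cof a b r).1 : ℤ) = (2 * r + 1) ^ 2 * d := by exact_mod_cast hd
    rw [had, hac] at hP2
    have hne : (2 * (r : ℤ) + 1) ≠ 0 := by positivity
    have : 3 * e ^ r = (2 * (r : ℤ) + 1) *
        (3 * d - e ^ r * (2 * r * (r + 1) * e * c) - c ^ 2 * P2) := by
      apply mul_left_cancel₀ hne
      linear_combination -hP2
    rw [← heu.dvd_mul_right]
    push_cast
    exact ⟨_, this⟩
  have h3 : (2 * r + 1) ∣ 3 := by exact_mod_cast h3
  have h4 := (Nat.prime_dvd_prime_iff_eq hp Nat.prime_three).mp h3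
  have hr1 : r = 1 := by omega
  refine ⟨hr1, s, hs2, ?_⟩
  rw [hpow, h4]

/-- Composition: `u_n` as a multiple of `u_m` for `n = p m`. -/
lemma cof_comp (k l u v m r i : ℕ) (hk : 0 < k) (hi : 2 * i + 1 = (2 * m + 1) * (2 * r + 1)) :
    u * (cof (k * u ^ 2) (l * v ^ 2) i).1 =
      u * (cof (k * u ^ 2) (l * v ^ 2) m).1 *
       (cof (k * (u * (cof (k * u ^ 2) (l * v ^ 2) m).1) ^ 2)
            (l * (v * (cof (k * u ^ 2) (l * v ^ 2) m).2) ^ 2) r).1 := by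
  have hkp : 0 < Real.sqrt k := Real.sqrt_pos.mpr (by exact_mod_cast hk)
  have hk2 : Real.sqrt k ^ 2 = k := Real.sq_sqrt (by positivity)
  have hl2 : Real.sqrt l ^ 2 = l := Real.sq_sqrt (by positivity)
  set A := (cof (k * u ^ 2) (l * v ^ 2) m).1 with hA
  set B := (cof (k * u ^ 2) (l * v ^ 2) m).2 with hB
  have q1 : ((u : ℝ) * Real.sqrt k) ^ 2 = ((k * u ^ 2 : ℕ) : ℝ) := by
    push_cast; rw [mul_pow, hk2]; ring
  have q2 : ((v : ℝ) * Real.sqrt l) ^ 2 = ((l * v ^ 2 : ℕ) : ℝ) := by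
    push_cast; rw [mul_pow, hl2]; ring
  have q3 : (-((v : ℝ) * Real.sqrt l)) ^ 2 = ((l * v ^ 2 : ℕ) : ℝ) := by rw [neg_sq, q2]
  have q4 : ((u : ℝ) * Real.sqrt k * A) ^ 2 = ((k * (u * A) ^ 2 : ℕ) : ℝ) := by
    push_cast; rw [mul_pow, mul_pow, hk2]; ring
  have q5 : ((v : ℝ) * Real.sqrt l * B) ^ 2 = ((l * (v * B) ^ 2 : ℕ) : ℝ) := by
    push_cast; rw [mul_pow, mul_pow, hl2]; ring
  have q6 : (-((v : ℝ) * Real.sqrt l) * B) ^ 2 = ((l * (v * B) ^ 2 : ℕ) : ℝ) := by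
    rw [neg_mul, neg_sq, q5]
  have f1 := cof_pow _ _ _ _ q1 q2 i
  have f2 := cof_pow _ _ _ _ q1 q3 i
  have g1 := cof_pow _ _ _ _ q1 q2 m
  have g2 := cof_pow _ _ _ _ q1 q3 m
  have h1 := cof_pow _ _ _ _ q4 q5 r
  have h2 := cof_pow _ _ _ _ q4 q6 r
  rw [← hA, ← hB] at g1 g2
  rw [hi, pow_mul, g1, h1] at f1
  rw [hi, pow_mul, g2, h2] at f2
  have : ((u * (cof (k * u ^ 2) (l * v ^ 2) i).1 : ℕ) : ℝ) =
      ((u * A * (cof (k * (u * A) ^ 2) (l * (v * B) ^ 2) r).1 : ℕ) : ℝ) := by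
    apply mul_left_cancel₀ hkp.ne'
    push_cast
    linear_combination -(f1 + f2) / 2
  exact_mod_cast this

lemma step (k l u v : ℕ) (e : ℤ) (he : e ^ 2 = 1) (hk : 0 < k) (hl : 0 < l) (hu : 0 < u)
    (hv : 0 < v) (h : (l : ℤ) * v ^ 2 = k * u ^ 2 + e) (i : ℕ) (hi : 1 ≤ i)
    (hq : ∀ q : ℕ, q.Prime → q ∣ u * (cof (k * u ^ 2) (l * v ^ 2) i).1 → q ∣ k) :
    ∃ m s, 2 * i + 1 = 3 * (2 * m + 1) ∧ 2 ≤ s ∧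
      u * (cof (k * u ^ 2) (l * v ^ 2) i).1 = u * (cof (k * u ^ 2) (l * v ^ 2) m).1 * 3 ^ s ∧
      ¬ 3 ∣ u * (cof (k * u ^ 2) (l * v ^ 2) m).1 := by
  set p := (2 * i + 1).minFac with hp
  have hpp : p.Prime := Nat.minFac_prime (by omega)
  obtain ⟨c, hc⟩ := Nat.minFac_dvd (2 * i + 1)
  rw [← hp] at hc
  have hodd : Odd (p * c) := by rw [← hc]; exact ⟨i, rfl⟩
  obtain ⟨⟨r, hr⟩, ⟨m, hm⟩⟩ := Nat.odd_mul.mp hodd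
  have hcomp := cof_comp k l u v m r i hk (by rw [hc, hr, hm]; ring)
  have hab : ((l * v ^ 2 : ℕ) : ℤ) = ((k * u ^ 2 : ℕ) : ℤ) + e := by push_cast; exact h
  have hnorm := cof_norm _ _ e he hab m
  have hpa : 1 ≤ k * u ^ 2 := Nat.succ_le_of_lt (by positivity)
  have hpb : 1 ≤ l * v ^ 2 := Nat.succ_le_of_lt (by positivity)
  have hge : 3 ≤ k * u ^ 2 + l * v ^ 2 := by
    rcases sq_eq_one_cases e he with h0 | h0 <;> omega
  obtain ⟨hB1, hA1, -⟩ := cof_size _ _ hge hpb m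
  set A := (cof (k * u ^ 2) (l * v ^ 2) m).1
  set B := (cof (k * u ^ 2) (l * v ^ 2) m).2
  have hA0 : 0 < A := by omega
  have hpa' : 1 ≤ k * (u * A) ^ 2 := Nat.succ_le_of_lt (by positivity)
  have hpb' : 1 ≤ l * (v * B) ^ 2 := Nat.succ_le_of_lt (by positivity)
  have hab' : ((l * (v * B) ^ 2 : ℕ) : ℤ) = ((k * (u * A) ^ 2 : ℕ) : ℤ) + e := by
    push_cast at hnorm ⊢; linear_combination hnorm
  obtain ⟨hr1, s, hs, hs3⟩ := cof_prime _ _ e he hab' hpa' hpb' r (hr ▸ hpp) (by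
    intro q hqp hqd
    exact Dvd.dvd.mul_right (hq q hqp (by rw [hcomp]; exact Dvd.dvd.mul_left hqd _)) _)
  have h3k : 3 ∣ k := hq 3 Nat.prime_three (by
    rw [hcomp, hs3]; exact Dvd.dvd.mul_left (dvd_pow_self _ (by omega)) _)
  refine ⟨m, s, ?_, hs, by rw [hcomp, hs3], ?_⟩
  · rw [hc, hr, hm, hr1]; ring
  · rintro ⟨w, hw⟩
    obtain ⟨k', hk'⟩ := h3k
    rw [hr1] at hs3
    simp only [cof] at hs3
    obtain ⟨t, rfl⟩ := Nat.exists_eq_add_of_le hs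
    rw [pow_add] at hs3
    have h9 : k * (u * A) ^ 2 = 9 * (3 * k' * w ^ 2) := by rw [hw, hk']; ring
    rw [h9] at hs3 hab'
    rcases sq_eq_one_cases e he with h0 | h0 <;> omega

lemma key (k l u v : ℕ) (e : ℤ) (he : e ^ 2 = 1) (hk : 0 < k) (hl : 0 < l) (hu : 0 < u)
    (hv : 0 < v) (h : (l : ℤ) * v ^ 2 = k * u ^ 2 + e) (i : ℕ) (hi : 1 ≤ i)
    (hq : ∀ q : ℕ, q.Prime → q ∣ u * (cof (k * u ^ 2) (l * v ^ 2) i).1 → q ∣ k) :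
    i = 1 ∧ ∃ s, 0 < s ∧ u * (cof (k * u ^ 2) (l * v ^ 2) i).1 = 3 ^ s * u ∧ ¬ 3 ∣ u ∧
      k * u ^ 2 + 3 * (l * v ^ 2) = 3 ^ s := by
  obtain ⟨m, s, h1, hs, h2, h3⟩ := step k l u v e he hk hl hu hv h i hi hq
  rcases Nat.eq_zero_or_pos m with h0 | h0
  · subst h0
    have hi1 : i = 1 := by omega
    simp only [cof, mul_one] at h2 h3
    subst hi1
    refine ⟨rfl, s, by omega, by rw [h2, mul_comm], h3, ?_⟩
    simp only [cof, mul_one] at h2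
    have := Nat.eq_of_mul_eq_mul_left hu h2
    omega
  · exfalso
    obtain ⟨m', s', -, hs', h2', -⟩ := step k l u v e he hk hl hu hv h m h0 (by
      intro q hqp hqd
      exact hq q hqp (by rw [h2]; exact Dvd.dvd.mul_right hqd _))
    exact h3 (by rw [h2']; exact Dvd.dvd.mul_left (dvd_pow_self _ (by omega)) _)

/-- Every positive solution is an odd power of the minimal one. -/
lemma all_sols (k l : ℕ) (hk : 1 < k)
    (x₁ y₁ : ℕ) (hx₁ : 0 < x₁) (hy₁ : 0 < y₁)
    (hsol₁ : (k : ℤ) * (x₁ : ℤ) ^ 2 - (l : ℤ) * (y₁ : ℤ) ^ 2 = 1)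
    (hmin : ∀ u v : ℕ, 0 < u → 0 < v →
      (k : ℤ) * (u : ℤ) ^ 2 - (l : ℤ) * (v : ℤ) ^ 2 = 1 →
      (x₁ : ℝ) * Real.sqrt k + (y₁ : ℝ) * Real.sqrt l ≤
        (u : ℝ) * Real.sqrt k + (v : ℝ) * Real.sqrt l)
    (x y : ℕ) (hx : 0 < x) (hy : 0 < y) (hl : 0 < l)
    (hsol : (k : ℤ) * (x : ℤ) ^ 2 - (l : ℤ) * (y : ℤ) ^ 2 = 1) :
    ∃ i : ℕ, (x : ℝ) * Real.sqrt k + (y : ℝ) * Real.sqrt l =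
      ((x₁ : ℝ) * Real.sqrt k + (y₁ : ℝ) * Real.sqrt l) ^ (2 * i + 1) := by
  have hkp : 1 < Real.sqrt k := by
    rw [Real.lt_sqrt (by norm_num)]; simpa using hk
  have hlp : 0 < Real.sqrt l := Real.sqrt_pos.mpr (by exact_mod_cast hl)
  have hk2 : Real.sqrt k ^ 2 = k := Real.sq_sqrt (by positivity)
  have hl2 : Real.sqrt l ^ 2 = l := Real.sq_sqrt (by positivity)
  set α := Real.sqrt k
  set β := Real.sqrt l
  set ε := (x₁ : ℝ) * α + (y₁ : ℝ) * β with hε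
  have hx1r : (1 : ℝ) ≤ x₁ := by exact_mod_cast hx₁
  have hy1r : (1 : ℝ) ≤ y₁ := by exact_mod_cast hy₁
  have hε1 : 1 < ε := by nlinarith
  have hε0 : 0 < ε := by linarith
  have hs1 : (k : ℝ) * x₁ ^ 2 - l * y₁ ^ 2 = 1 := by exact_mod_cast hsol₁
  have hεinv : ε * ((x₁ : ℝ) * α - (y₁ : ℝ) * β) = 1 := by
    rw [hε]; linear_combination (x₁:ℝ) ^ 2 * hk2 - (y₁:ℝ) ^ 2 * hl2 + hs1
  -- integer solutions divided by even powers
  have hdiv : ∀ j : ℕ, ∃ X Y : ℤ, (k : ℤ) * X ^ 2 - (l : ℤ) * Y ^ 2 = 1 ∧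
      ((X : ℝ) * α + Y * β) * (ε ^ 2) ^ j = (x : ℝ) * α + (y : ℝ) * β := by
    intro j
    induction j with
    | zero => exact ⟨x, y, hsol, by simp⟩
    | succ j ih =>
      obtain ⟨X, Y, h1, h2⟩ := ih
      refine ⟨(k * x₁ ^ 2 + l * y₁ ^ 2) * X - 2 * x₁ * y₁ * l * Y,
        (k * x₁ ^ 2 + l * y₁ ^ 2) * Y - 2 * x₁ * y₁ * k * X, ?_, ?_⟩
      · linear_combination ((k:ℤ) * X ^ 2 - l * Y ^ 2) *
          ((k : ℤ) * (x₁ : ℤ) ^ 2 - (l : ℤ) * (y₁ : ℤ) ^ 2 + 1) * hsol₁ + h1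
      · rw [← h2]
        have hz : (((k * x₁ ^ 2 + l * y₁ ^ 2) * X - 2 * x₁ * y₁ * l * Y : ℤ) : ℝ) * α +
            (((k * x₁ ^ 2 + l * y₁ ^ 2) * Y - 2 * x₁ * y₁ * k * X : ℤ) : ℝ) * β =
            ((X : ℝ) * α + Y * β) * ((x₁ : ℝ) * α - (y₁ : ℝ) * β) ^ 2 := by
          push_cast
          rw [← hk2, ← hl2]
          ring
        rw [hz, pow_succ]
        have : (ε * ((x₁ : ℝ) * α - (y₁ : ℝ) * β)) ^ 2 = 1 := by rw [hεinv]; norm_num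
        linear_combination ((X : ℝ) * α + Y * β) * (ε ^ 2) ^ j * this
  have hη := hmin x y hx hy hsol
  have h1 : 1 ≤ ((x : ℝ) * α + (y : ℝ) * β) / ε := by rwa [one_le_div hε0]
  obtain ⟨i, hi1, hi2⟩ := exists_nat_pow_near h1 (show 1 < ε ^ 2 by nlinarith)
  rw [le_div_iff₀ hε0] at hi1
  rw [div_lt_iff₀ hε0] at hi2
  obtain ⟨X, Y, hXY, hf⟩ := hdiv (i + 1)
  refine ⟨i, ?_⟩
  have hpe : 0 < (ε ^ 2) ^ (i + 1) := by positivity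
  have hsr : (k : ℝ) * X ^ 2 - l * Y ^ 2 = 1 := by exact_mod_cast hXY
  have hconj : ((X : ℝ) * α + Y * β) * ((X : ℝ) * α - Y * β) = 1 := by
    linear_combination (X:ℝ) ^ 2 * hk2 - (Y:ℝ) ^ 2 * hl2 + hsr
  set f := (X : ℝ) * α + Y * β with hfdef
  have hflt : f < ε := by
    rw [← hf, mul_comm _ ε] at hi2
    exact lt_of_mul_lt_mul_right hi2 hpe.le
  have hfge : 1 ≤ f * ε := by
    rw [← hf, pow_succ (ε ^ 2) i] at hi1
    have h0 : 0 < (ε ^ 2) ^ i * ε := by positivity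
    have : 1 * ((ε ^ 2) ^ i * ε) ≤ (f * ε) * ((ε ^ 2) ^ i * ε) := by
      calc 1 * ((ε ^ 2) ^ i * ε) = (ε ^ 2) ^ i * ε := one_mul _
        _ ≤ f * ((ε ^ 2) ^ i * ε ^ 2) := hi1
        _ = (f * ε) * ((ε ^ 2) ^ i * ε) := by ring
    exact le_of_mul_le_mul_right this h0
  have hf0 : 0 < f := pos_of_mul_pos_left (lt_of_lt_of_le one_pos hfge) hε0.le
  have hg0 : 0 < (X : ℝ) * α - Y * β :=
    pos_of_mul_pos_right (lt_of_lt_of_eq one_pos hconj.symm) hf0.le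
  have hX0 : 0 < X := by
    have : (0 : ℝ) < X * α := by rw [hfdef] at hf0; linarith
    have : (0 : ℝ) < X := pos_of_mul_pos_left this (by linarith)
    exact_mod_cast this
  have hY0 : Y ≠ 0 := by
    rintro rfl
    have : (k : ℤ) * X ^ 2 = 1 := by linarith
    have hkd : (k : ℤ) ∣ 1 := ⟨_, this.symm⟩
    have : (k : ℤ) ≤ 1 := Int.le_of_dvd one_pos hkd
    omega
  have hmin' : ∀ Z : ℤ, 0 < Z → Z ^ 2 = Y ^ 2 → ε ≤ X * α + Z * β := by
    intro Z hZ hZY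
    have := hmin X.toNat Z.toNat (by omega) (by omega) (by
      rw [Int.toNat_of_nonneg hX0.le, Int.toNat_of_nonneg hZ.le, hZY]; exact hXY)
    have c1 : ((X.toNat : ℕ) : ℝ) = X := by
      exact_mod_cast congrArg (Int.cast (R := ℝ)) (Int.toNat_of_nonneg hX0.le)
    have c2 : ((Z.toNat : ℕ) : ℝ) = Z := by
      exact_mod_cast congrArg (Int.cast (R := ℝ)) (Int.toNat_of_nonneg hZ.le)
    rwa [c1, c2] at this
  rcases lt_or_gt_of_ne hY0 with hneg | hpos
  · have h5 := hmin' (-Y) (by omega) (by ring)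
    push_cast at h5
    have h6 : f * ε ≤ 1 := by
      rw [← hconj]
      exact mul_le_mul_of_nonneg_left (by linarith) hf0.le
    have h7 : f * ε = 1 := le_antisymm h6 hfge
    rw [← hf]
    calc f * (ε ^ 2) ^ (i + 1) = (f * ε) * ε ^ (2 * i + 1) := by ring
      _ = _ := by rw [h7, one_mul]
  · have h5 := hmin' Y hpos rfl
    linarith

/-- The pair of coordinates is determined by the value. -/
lemma coords (k l x y X Y : ℕ) (hk : 0 < k) (hl : 0 < l) (hx : 0 < x)
    (hsol : (k : ℤ) * (x : ℤ) ^ 2 - (l : ℤ) * (y : ℤ) ^ 2 = 1)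
    (hsol' : (k : ℤ) * (X : ℤ) ^ 2 - (l : ℤ) * (Y : ℤ) ^ 2 = 1)
    (h : (x : ℝ) * Real.sqrt k + (y : ℝ) * Real.sqrt l =
      (X : ℝ) * Real.sqrt k + (Y : ℝ) * Real.sqrt l) : x = X ∧ y = Y := by
  have hkp : 0 < Real.sqrt k := Real.sqrt_pos.mpr (by exact_mod_cast hk)
  have hlp : 0 < Real.sqrt l := Real.sqrt_pos.mpr (by exact_mod_cast hl)
  have hk2 : Real.sqrt k ^ 2 = k := Real.sq_sqrt (by positivity)
  have hl2 : Real.sqrt l ^ 2 = l := Real.sq_sqrt (by positivity)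
  have h1 : (k : ℝ) * x ^ 2 - l * y ^ 2 = 1 := by exact_mod_cast hsol
  have h2 : (k : ℝ) * X ^ 2 - l * Y ^ 2 = 1 := by exact_mod_cast hsol'
  set α := Real.sqrt k
  set β := Real.sqrt l
  have hxr : (0 : ℝ) < x := by exact_mod_cast hx
  have hf : 0 < (x : ℝ) * α + (y : ℝ) * β := by positivity
  have hg : (x : ℝ) * α - (y : ℝ) * β = (X : ℝ) * α - (Y : ℝ) * β := by
    apply mul_left_cancel₀ hf.ne'
    have e1 : ((x : ℝ) * α + y * β) * ((x : ℝ) * α - y * β) = 1 := by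
      linear_combination (x:ℝ) ^ 2 * hk2 - (y:ℝ) ^ 2 * hl2 + h1
    have e2 : ((X : ℝ) * α + Y * β) * ((X : ℝ) * α - Y * β) = 1 := by
      linear_combination (X:ℝ) ^ 2 * hk2 - (Y:ℝ) ^ 2 * hl2 + h2
    rw [e1, h, e2]
  constructor
  · have : (x : ℝ) = X := mul_right_cancel₀ hkp.ne' (by linarith)
    exact_mod_cast this
  · have : (y : ℝ) = Y := mul_right_cancel₀ hlp.ne' (by linarith)
    exact_mod_cast this

/-- Walker/Sun–Yuan extension of Störmer's theorem for `k x² - l y² = 1`. -/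
theorem stormer_kl_one (k l : ℕ) (hk : 1 < k) (hl : 0 < l)
    (hco : Nat.Coprime k l) (hns : ¬ IsSquare (k * l))
    (x₁ y₁ : ℕ) (hx₁ : 0 < x₁) (hy₁ : 0 < y₁)
    (hsol₁ : (k : ℤ) * (x₁ : ℤ) ^ 2 - (l : ℤ) * (y₁ : ℤ) ^ 2 = 1)
    (hmin : ∀ u v : ℕ, 0 < u → 0 < v →
      (k : ℤ) * (u : ℤ) ^ 2 - (l : ℤ) * (v : ℤ) ^ 2 = 1 →
      (x₁ : ℝ) * Real.sqrt k + (y₁ : ℝ) * Real.sqrt l ≤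
        (u : ℝ) * Real.sqrt k + (v : ℝ) * Real.sqrt l)
    (x y : ℕ) (hx : 0 < x) (hy : 0 < y)
    (hsol : (k : ℤ) * (x : ℤ) ^ 2 - (l : ℤ) * (y : ℤ) ^ 2 = 1) :
    ((∀ p : ℕ, p.Prime → p ∣ x → p ∣ k) →
      ((x : ℝ) * Real.sqrt k + (y : ℝ) * Real.sqrt l =
          (x₁ : ℝ) * Real.sqrt k + (y₁ : ℝ) * Real.sqrt l ∨
        ((x : ℝ) * Real.sqrt k + (y : ℝ) * Real.sqrt l =
            ((x₁ : ℝ) * Real.sqrt k + (y₁ : ℝ) * Real.sqrt l) ^ 3 ∧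
          ∃ s : ℕ, 0 < s ∧ x = 3 ^ s * x₁ ∧ ¬ (3 ∣ x₁) ∧
            3 ^ s + 3 = 4 * k * x₁ ^ 2))) ∧
    ((∀ p : ℕ, p.Prime → p ∣ y → p ∣ l) →
      ((x : ℝ) * Real.sqrt k + (y : ℝ) * Real.sqrt l =
          (x₁ : ℝ) * Real.sqrt k + (y₁ : ℝ) * Real.sqrt l ∨
        ((x : ℝ) * Real.sqrt k + (y : ℝ) * Real.sqrt l =
            ((x₁ : ℝ) * Real.sqrt k + (y₁ : ℝ) * Real.sqrt l) ^ 3 ∧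
          ∃ s : ℕ, 0 < s ∧ y = 3 ^ s * y₁ ∧ ¬ (3 ∣ y₁) ∧
            3 ^ s = 4 * l * y₁ ^ 2 + 3))) := by
  obtain ⟨i, hi⟩ := all_sols k l hk x₁ y₁ hx₁ hy₁ hsol₁ hmin x y hx hy hl hsol
  have hk0 : 0 < k := by omega
  have hk2 : Real.sqrt k ^ 2 = k := Real.sq_sqrt (by positivity)
  have hl2 : Real.sqrt l ^ 2 = l := Real.sq_sqrt (by positivity)
  have q1 : ((x₁ : ℝ) * Real.sqrt k) ^ 2 = ((k * x₁ ^ 2 : ℕ) : ℝ) := by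
    push_cast; rw [mul_pow, hk2]; ring
  have q2 : ((y₁ : ℝ) * Real.sqrt l) ^ 2 = ((l * y₁ ^ 2 : ℕ) : ℝ) := by
    push_cast; rw [mul_pow, hl2]; ring
  have hpw := cof_pow _ _ _ _ q1 q2 i
  have hab : ((l * y₁ ^ 2 : ℕ) : ℤ) = ((k * x₁ ^ 2 : ℕ) : ℤ) + (-1) := by push_cast; linarith
  have hnorm := cof_norm _ _ (-1) (by norm_num) hab i
  have hc := coords k l x y (x₁ * (cof (k * x₁ ^ 2) (l * y₁ ^ 2) i).1)
    (y₁ * (cof (k * x₁ ^ 2) (l * y₁ ^ 2) i).2) hk0 hl hx hsol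
    (by push_cast at hnorm ⊢; linear_combination -hnorm)
    (by rw [hi, hpw]; push_cast; ring)
  obtain ⟨hxe, hye⟩ := hc
  rcases Nat.eq_zero_or_pos i with h0 | h0
  · subst h0
    simp only [Nat.mul_zero, Nat.zero_add, pow_one] at hi
    exact ⟨fun _ => Or.inl hi, fun _ => Or.inl hi⟩
  constructor
  · intro hq
    right
    obtain ⟨hi1, s, hs, h1, h2, h3⟩ := key k l x₁ y₁ (-1) (by norm_num) hk0 hl hx₁ hy₁
      (by linarith) i h0 (by rw [← hxe]; exact hq)
    refine ⟨by rw [hi, hi1], s, hs, by rw [hxe, h1], h2, ?_⟩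
    have : (4 * k * x₁ ^ 2) = 4 * (k * x₁ ^ 2) := by ring
    omega
  · intro hq
    right
    have hsw := (cof_swap (k * x₁ ^ 2) (l * y₁ ^ 2) i).1
    obtain ⟨hi1, s, hs, h1, h2, h3⟩ := key l k y₁ x₁ 1 (by norm_num) hl hk0 hy₁ hx₁
      (by linarith) i h0 (by rw [hsw, ← hye]; exact hq)
    refine ⟨by rw [hi, hi1], s, hs, by rw [hye, ← hsw, h1], h2, ?_⟩
    have : (4 * l * y₁ ^ 2) = 4 * (l * y₁ ^ 2) := by ring
    omega
end

section
/- Let k, l be coprime odd positive integers with kl nonsquare, such that k x² − l y² = 2 has a positive integer solution, and let ε = x₁√k + y₁√l where (x₁, y₁) is the minimal positive solution. Let (x, y) be any positive integer solution of k x² − l y² = 2. (i) If every prime divisor of x divides k, then x√k + y√l = ε, or (x√k + y√l)/√2 = (ε/√2)³ and there is a positive integer s with x = 3ˢ x₁, 3 ∤ x₁, and 3ˢ + 3 = 2 k x₁². (ii) If every prime divisor of y divides l, then x√k + y√l = ε, or (x√k + y√l)/√2 = (ε/√2)³ and there is a positive integer s with y = 3ˢ y₁, 3 ∤ y₁, and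 3ˢ − 3 = 2 l y₁². -/
/-- The polynomials `sinh ((2i+1)θ) / sinh θ` in `w = 2 sinh² θ`. -/
def Qs (w : ℤ) : ℕ → ℤ
  | 0 => 1
  | 1 => 2 * w + 3
  | (n + 2) => (2 * w + 2) * Qs w (n + 1) - Qs w n

lemma Qs_zero (w : ℤ) : Qs w 0 = 1 := rfl
lemma Qs_one (w : ℤ) : Qs w 1 = 2 * w + 3 := rfl
lemma Qs_two (w : ℤ) (n : ℕ) : Qs w (n + 2) = (2 * w + 2) * Qs w (n + 1) - Qs w n := rfl

lemma Qs_mod (w : ℤ) (i : ℕ) : ∃ t : ℤ, Qs w i = (2 * i + 1) + w * t := by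
  have H : ∀ i : ℕ, (∃ t : ℤ, Qs w i = (2 * i + 1) + w * t) ∧
      (∃ t : ℤ, Qs w (i + 1) = (2 * (i + 1) + 1) + w * t) := by
    intro i
    induction i with
    | zero => exact ⟨⟨0, by simp [Qs_zero]⟩, ⟨2, by simp [Qs_one]; ring⟩⟩
    | succ n ih =>
      obtain ⟨⟨t, ht⟩, ⟨r, hr⟩⟩ := ih
      refine ⟨⟨r, by push_cast; exact hr⟩, ⟨(2 * w + 2) * r + 2 * (2 * (n + 1) + 1) - t, ?_⟩⟩
      rw [Qs_two, ht, hr]; push_cast; ring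
  exact (H i).1

lemma Qs_mod2 (w : ℤ) (i : ℕ) : ∃ t : ℤ,
    3 * Qs w i = (2 * i + 1) * (3 + i * (i + 1) * w) + w ^ 2 * t := by
  have H : ∀ i : ℕ, (∃ t : ℤ, 3 * Qs w i = (2 * i + 1) * (3 + i * (i + 1) * w) + w ^ 2 * t) ∧
      (∃ t : ℤ, 3 * Qs w (i + 1) =
        (2 * (i + 1) + 1) * (3 + (i + 1) * (i + 2) * w) + w ^ 2 * t) := by
    intro i
    induction i with
    | zero => exact ⟨⟨0, by simp [Qs_zero]⟩, ⟨0, by simp [Qs_one]; ring⟩⟩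
    | succ n ih =>
      obtain ⟨⟨t, ht⟩, ⟨r, hr⟩⟩ := ih
      refine ⟨⟨r, by push_cast; rw [hr]; ring⟩,
        ⟨(2 * w + 2) * r + 2 * (2 * (n + 1) + 1) * ((n + 1) * (n + 2)) - t, ?_⟩⟩
      rw [Qs_two, mul_sub, show 3 * ((2 * w + 2) * Qs w (n + 1)) =
        (2 * w + 2) * (3 * Qs w (n + 1)) by ring, ht, hr]; push_cast; ring
  exact (H i).1

lemma growth (T : ℕ → ℤ) (K : ℤ) (hK : 4 ≤ K) (h0 : T 0 = 1) (h1 : 3 ≤ T 1)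
    (h2 : ∀ n, T (n + 2) = K * T (n + 1) - T n) (i : ℕ) :
    (2 * i + 3 ≤ T (i + 1)) ∧ 2 * i + 5 < T (i + 2) := by
  have H : ∀ i : ℕ, (2 * (i : ℤ) + 1 ≤ T i) ∧ T i + 2 ≤ T (i + 1) := by
    intro i
    induction i with
    | zero => simp [h0]; linarith
    | succ n ih =>
      obtain ⟨ha, hb⟩ := ih
      refine ⟨by push_cast; linarith, ?_⟩
      rw [h2]; nlinarith
  obtain ⟨ha, hb⟩ := H i
  refine ⟨by linarith, ?_⟩
  rw [h2]; nlinarith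

lemma Qs_growth (w : ℤ) (hw : 1 ≤ w ∨ w ≤ -3) (i : ℕ) :
    (2 * i + 3 ≤ |Qs w (i + 1)|) ∧ 2 * i + 5 < |Qs w (i + 2)| := by
  rcases hw with hw | hw
  · have := growth (Qs w) (2 * w + 2) (by linarith) rfl (by rw [Qs_one]; linarith) (Qs_two w) i
    exact ⟨this.1.trans (le_abs_self _), this.2.trans_le (le_abs_self _)⟩
  · have := growth (fun n => (-1) ^ n * Qs w n) (-2 * w - 2) (by linarith) (by simp [Qs_zero])
      (by simp [Qs_one]; linarith) (by intro n; simp only [Qs_two]; ring) i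
    have e : ∀ n, |Qs w n| = |(-1) ^ n * Qs w n| := by intro n; simp [abs_mul]
    rw [e, e]
    exact ⟨this.1.trans (le_abs_self _), this.2.trans_le (le_abs_self _)⟩

lemma arith (w : ℤ) (hw : 1 ≤ w ∨ w ≤ -3) (i : ℕ) (hi : 1 ≤ i) (hp : (2 * i + 1).Prime)
    (hq : ∀ q : ℕ, q.Prime → (q : ℤ) ∣ Qs w i → (q : ℤ) ∣ w) :
    i = 1 ∧ ∃ s : ℕ, 0 < s ∧ |Qs w i| = 3 ^ s := by
  have hge : 3 ≤ |Qs w i| := by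
    obtain ⟨j, rfl⟩ := Nat.exists_eq_add_of_le' hi
    have := (Qs_growth w hw j).1
    have : (0 : ℤ) ≤ j := by positivity
    linarith
  have hpow : ∃ s : ℕ, (Qs w i).natAbs = (2 * i + 1) ^ s := by
    refine ⟨_, Nat.eq_prime_pow_of_unique_prime_dvd ?_ ?_⟩
    · intro h; rw [Int.natAbs_eq_zero] at h; rw [h] at hge; simp at hge
    · intro d hd hdvd
      have h1 : (d : ℤ) ∣ Qs w i := Int.natCast_dvd.2 hdvd
      have h2 := hq d hd h1
      obtain ⟨t, ht⟩ := Qs_mod w i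
      have h3 : (d : ℤ) ∣ ((2 * i + 1 : ℕ) : ℤ) := by
        have : ((2 * i + 1 : ℕ) : ℤ) = Qs w i - w * t := by rw [ht]; push_cast; ring
        rw [this]; exact dvd_sub h1 (h2.mul_right t)
      exact (Nat.prime_dvd_prime_iff_eq hd hp).1 (by exact_mod_cast h3)
  obtain ⟨s, hs⟩ := hpow
  have hs' : |Qs w i| = ((2 * i + 1 : ℕ) : ℤ) ^ s := by
    rw [Int.abs_eq_natAbs, hs]; push_cast; ring
  have hs0 : 0 < s := by
    rcases Nat.eq_zero_or_pos s with h | h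
    · rw [h] at hs'; rw [hs'] at hge; simp at hge
    · exact h
  have hi1 : i = 1 := by
    by_contra hne
    obtain ⟨j, rfl⟩ := Nat.exists_eq_add_of_le' (show 2 ≤ i by omega)
    have hbig := (Qs_growth w hw j).2
    have hs2 : 2 ≤ s := by
      by_contra hlt
      have : s = 1 := by omega
      rw [hs', this] at hbig; push_cast at hbig; linarith
    have hpq : ((2 * (j + 2) + 1 : ℕ) : ℤ) ^ 2 ∣ Qs w (j + 2) := by
      rw [← dvd_abs, hs']; exact pow_dvd_pow _ hs2
    have hpw : ((2 * (j + 2) + 1 : ℕ) : ℤ) ∣ w :=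
      hq _ hp ((dvd_pow_self _ two_ne_zero).trans hpq)
    obtain ⟨t, ht⟩ := Qs_mod2 w (j + 2)
    obtain ⟨a, ha⟩ := hpq
    obtain ⟨b, hb⟩ := hpw
    set P : ℤ := ((2 * (j + 2) + 1 : ℕ) : ℤ) with hP
    have hP' : (2 * ((j + 2 : ℕ) : ℤ) + 1) = P := by rw [hP]; push_cast; ring
    have hPpos : 5 ≤ P := by rw [hP]; push_cast; linarith [(by positivity : (0 : ℤ) ≤ j)]
    rw [hP', ha] at ht
    have : P * (3 * (P * a)) =
        P * (3 + ((j + 2 : ℕ) : ℤ) * (((j + 2 : ℕ) : ℤ) + 1) * w + P * b ^ 2 * t) := by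
      rw [hb] at ht ⊢; linear_combination ht
    have := mul_left_cancel₀ (by linarith) this
    have h3 : P ∣ 3 := ⟨3 * a - ((j + 2 : ℕ) : ℤ) * (((j + 2 : ℕ) : ℤ) + 1) * b - b ^ 2 * t, by
      rw [hb] at this; linear_combination -this⟩
    have := Int.le_of_dvd (by norm_num) h3
    linarith
  refine ⟨hi1, s, hs0, ?_⟩
  rw [hs', hi1]; norm_num

lemma no_three (c v : ℤ) (hw : 1 ≤ c * v ^ 2 ∨ c * v ^ 2 ≤ -3) (hc : 3 ∣ c) (s : ℕ)
    (h : |Qs (c * v ^ 2) 1| = 3 ^ s) : ¬ 3 ∣ v := by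
  rintro ⟨d, rfl⟩
  obtain ⟨e, rfl⟩ := hc
  rw [Qs_one] at h
  have hs : s < 2 := by
    by_contra hs
    have h9 : (3 : ℤ) ^ 2 ∣ 2 * (3 * e * (3 * d) ^ 2) + 3 := by
      rw [← dvd_abs, h]; exact pow_dvd_pow _ (by omega)
    obtain ⟨f, hf⟩ := h9
    have : 2 * (3 * e * (3 * d) ^ 2) = 9 * (6 * (e * d ^ 2)) := by ring
    omega
  have e1 : (3 * e * (3 * d) ^ 2) = 27 * (e * d ^ 2) := by ring
  rw [e1] at h hw
  have : (3 : ℤ) ^ s ≤ 3 := by interval_cases s <;> norm_num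
  have := abs_le.1 (h.trans_le this)
  omega

lemma dio (c u : ℤ) (Z : ℕ → ℤ) (hZ : ∀ m, |Z m| = |u * Qs (c * u ^ 2) m|)
    (hw : ∀ m, 1 ≤ c * Z m ^ 2 ∨ c * Z m ^ 2 ≤ -3)
    (hcomp : ∀ m i j, 2 * j + 1 = (2 * m + 1) * (2 * i + 1) →
      |Z j| = |Z m * Qs (c * Z m ^ 2) i|)
    (j : ℕ) (hj : 1 ≤ j) (hq : ∀ q : ℕ, q.Prime → (q : ℤ) ∣ Z j → (q : ℤ) ∣ c) :
    j = 1 ∧ ∃ s : ℕ, 0 < s ∧ |Qs (c * u ^ 2) 1| = 3 ^ s ∧ ¬ 3 ∣ u := by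
  have key : ∀ m i, 1 ≤ i → (2 * i + 1).Prime → 2 * j + 1 = (2 * m + 1) * (2 * i + 1) →
      i = 1 ∧ ∃ s : ℕ, 0 < s ∧ |Qs (c * Z m ^ 2) i| = 3 ^ s := by
    intro m i hi hp h
    refine arith _ (hw m) i hi hp ?_
    intro q hqp hd
    refine (hq q hqp ?_).mul_right _
    rw [← dvd_abs, hcomp m i j h, dvd_abs]
    exact hd.mul_left _
  have all3 : ∀ p : ℕ, p.Prime → p ∣ 2 * j + 1 → p = 3 := by
    intro p hp ⟨n, hn⟩
    have ho : Odd (p * n) := ⟨j, hn.symm⟩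
    obtain ⟨⟨i, rfl⟩, ⟨m, rfl⟩⟩ := Nat.odd_mul.1 ho
    have h1 := hp.one_lt
    have := (key m i (by omega) hp (by rw [hn, mul_comm])).1
    omega
  have h3 : 3 ∣ 2 * j + 1 := by
    obtain ⟨p, hp, hd⟩ := Nat.exists_prime_and_dvd (show 2 * j + 1 ≠ 1 by omega)
    rwa [all3 p hp hd] at hd
  obtain ⟨n, hn⟩ := h3
  obtain ⟨m, rfl⟩ : Odd n := (Nat.odd_mul.1 (⟨j, hn.symm⟩ : Odd (3 * n))).2
  obtain ⟨-, s, hs, hs2⟩ := key m 1 le_rfl (by norm_num) (by rw [hn]; ring)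
  have h3Q : (3 : ℤ) ∣ Qs (c * Z m ^ 2) 1 := by
    rw [← dvd_abs, hs2]; exact dvd_pow_self _ hs.ne'
  have h3c : (3 : ℤ) ∣ c := by
    have := hq 3 Nat.prime_three
    push_cast at this
    apply this
    rw [← dvd_abs, hcomp m 1 j (by rw [hn]; ring), dvd_abs]
    exact h3Q.mul_left _
  have hm3 := no_three c (Z m) (hw m) h3c s hs2
  have hm : m = 0 := by
    by_contra hm
    apply hm3
    obtain ⟨p, hp, hd⟩ := Nat.exists_prime_and_dvd (show 2 * m + 1 ≠ 1 by omega)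
    have hp3 := all3 p hp (by rw [hn]; exact hd.mul_left _)
    subst hp3
    obtain ⟨n', hn'⟩ := hd
    obtain ⟨m', rfl⟩ : Odd n' := (Nat.odd_mul.1 (⟨m, hn'.symm⟩ : Odd (3 * n'))).2
    rw [← dvd_abs, hcomp m' 1 m (by rw [hn']; ring), dvd_abs, Qs_one]
    apply Dvd.dvd.mul_left
    exact dvd_add ((h3c.mul_right _).mul_left _) (dvd_refl 3)
  subst hm
  have hZ0 := hZ 0
  rw [Qs_zero, mul_one] at hZ0
  have hsq : Z 0 ^ 2 = u ^ 2 := by rw [← sq_abs, hZ0, sq_abs]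
  rw [hsq] at hs2
  refine ⟨by omega, s, hs, hs2, ?_⟩
  rwa [← dvd_abs, ← hZ0, dvd_abs]

/-- odd powers -/
lemma powers (k l : ℕ) (u v : ℤ) (h : (k : ℤ) * u ^ 2 - l * v ^ 2 = 2) (i : ℕ) :
    (((u : ℝ) * √k + v * √l) / √2) ^ (2 * i + 1) =
      (((u * ((-1) ^ i * Qs (-k * u ^ 2) i) : ℤ) : ℝ) * √k +
        ((v * Qs (l * v ^ 2) i : ℤ) : ℝ) * √l) / √2 := by
  have hk : √(k : ℝ) ^ 2 = k := Real.sq_sqrt (by positivity)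
  have hl : √(l : ℝ) ^ 2 = l := Real.sq_sqrt (by positivity)
  have h2 : √(2 : ℝ) ^ 2 = 2 := Real.sq_sqrt (by positivity)
  have hR : (k : ℝ) * u ^ 2 - l * v ^ 2 = 2 := by exact_mod_cast h
  have h20 : √(2 : ℝ) ≠ 0 := by positivity
  set α : ℝ := ((u : ℝ) * √k + v * √l) / √2 with hα
  have hα2 : α ^ 2 = (k * u ^ 2 + l * v ^ 2) / 2 + u * v * √k * √l := by
    rw [hα, div_pow, h2]; linear_combination (u ^ 2 / 2 : ℝ) * hk + (v ^ 2 / 2 : ℝ) * hl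
  have hα4 : α ^ 4 = (k * u ^ 2 + l * v ^ 2) * α ^ 2 - 1 := by
    have hkl : (√(k : ℝ) * √l) ^ 2 = k * l := by rw [mul_pow, hk, hl]
    rw [show α ^ 4 = (α ^ 2) ^ 2 by ring, hα2]
    linear_combination (u ^ 2 * v ^ 2 : ℝ) * hkl -
      (1 / 4 : ℝ) * ((k : ℝ) * u ^ 2 - l * v ^ 2 + 2) * hR
  have H : ∀ i : ℕ, (α ^ (2 * i + 1) =
      (((u * ((-1) ^ i * Qs (-k * u ^ 2) i) : ℤ) : ℝ) * √k +
        ((v * Qs (l * v ^ 2) i : ℤ) : ℝ) * √l) / √2) ∧ (α ^ (2 * (i + 1) + 1) =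
      (((u * ((-1) ^ (i + 1) * Qs (-k * u ^ 2) (i + 1)) : ℤ) : ℝ) * √k +
        ((v * Qs (l * v ^ 2) (i + 1) : ℤ) : ℝ) * √l) / √2) := by
    intro i
    induction i with
    | zero =>
      refine ⟨by simp [Qs_zero, hα], ?_⟩
      rw [show 2 * (0 + 1) + 1 = 2 + 1 by norm_num, pow_succ, hα2, hα]
      simp only [zero_add, Qs_one]
      push_cast
      rw [← mul_div_assoc]
      congr 1
      linear_combination (u * √k * (-3 / 2) + v * √l * (3 / 2) : ℝ) * hR +
        (u ^ 2 * v * √l : ℝ) * hk + (u * v ^ 2 * √k) * hl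
    | succ n ih =>
      obtain ⟨ha, hb⟩ := ih
      refine ⟨hb, ?_⟩
      have : α ^ (2 * (n + 1 + 1) + 1) =
          (k * u ^ 2 + l * v ^ 2) * α ^ (2 * (n + 1) + 1) - α ^ (2 * n + 1) := by
        linear_combination α ^ (2 * n + 1) * hα4
      rw [this, ha, hb, Qs_two, Qs_two, ← mul_div_assoc, ← sub_div]
      congr 1
      push_cast
      generalize (Qs (-k * u ^ 2) (n + 1) : ℝ) = A
      generalize (Qs (l * v ^ 2) (n + 1) : ℝ) = B
      linear_combination (B * v * √l - u * (-1) ^ (n + 1) * A * √k) * hR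
  exact (H i).1

lemma uniq (k l : ℕ) (hk : 0 < k) (hl : 0 < l) (u v x y : ℤ)
    (h : (k : ℤ) * u ^ 2 - l * v ^ 2 = 2) (h' : (k : ℤ) * x ^ 2 - l * y ^ 2 = 2)
    (e : (u : ℝ) * √k + v * √l = (x : ℝ) * √k + y * √l) : u = x ∧ v = y := by
  have hk2 : √(k : ℝ) ^ 2 = k := Real.sq_sqrt (by positivity)
  have hl2 : √(l : ℝ) ^ 2 = l := Real.sq_sqrt (by positivity)
  have hk0 : √(k : ℝ) ≠ 0 := by positivity
  have hl0 : √(l : ℝ) ≠ 0 := by positivity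
  have hR : (k : ℝ) * u ^ 2 - l * v ^ 2 = 2 := by exact_mod_cast h
  have hR' : (k : ℝ) * x ^ 2 - l * y ^ 2 = 2 := by exact_mod_cast h'
  have a1 : ((u : ℝ) * √k + v * √l) * (u * √k - v * √l) = 2 := by
    linear_combination hR + u ^ 2 * hk2 - v ^ 2 * hl2
  have a2 : ((u : ℝ) * √k + v * √l) * (x * √k - y * √l) = 2 := by
    rw [e]; linear_combination hR' + x ^ 2 * hk2 - y ^ 2 * hl2
  have a0 : (u : ℝ) * √k + v * √l ≠ 0 := by intro h0; rw [h0] at a1; simp at a1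
  have e2 := mul_left_cancel₀ a0 (a1.trans a2.symm)
  have e3 : (u : ℝ) = x := mul_right_cancel₀ hk0 (by linarith)
  have e4 : (v : ℝ) = y := mul_right_cancel₀ hl0 (by linarith)
  exact ⟨by exact_mod_cast e3, by exact_mod_cast e4⟩

lemma powers_norm (k l : ℕ) (u v : ℤ) (h : (k : ℤ) * u ^ 2 - l * v ^ 2 = 2) (i : ℕ) :
    (k : ℤ) * (u * ((-1) ^ i * Qs (-k * u ^ 2) i)) ^ 2 - l * (v * Qs (l * v ^ 2) i) ^ 2 = 2 := by
  have hk2 : √(k : ℝ) ^ 2 = k := Real.sq_sqrt (by positivity)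
  have hl2 : √(l : ℝ) ^ 2 = l := Real.sq_sqrt (by positivity)
  have h2 : √(2 : ℝ) ^ 2 = 2 := Real.sq_sqrt (by positivity)
  have h20 : √(2 : ℝ) ≠ 0 := by positivity
  have hR : (k : ℝ) * u ^ 2 - l * v ^ 2 = 2 := by exact_mod_cast h
  have p1 := powers k l u v h i
  have p2 := powers k l u (-v) (by rw [neg_sq]; exact h) i
  have one : (((u : ℝ) * √k + v * √l) / √2) * (((u : ℝ) * √k + (-v : ℤ) * √l) / √2) = 1 := by
    rw [div_mul_div_comm, ← sq, h2, div_eq_one_iff_eq two_ne_zero]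
    push_cast
    linear_combination hR + u ^ 2 * hk2 - v ^ 2 * hl2
  have := congrArg (· ^ (2 * i + 1)) one
  simp only [mul_pow, one_pow] at this
  rw [p1, p2, div_mul_div_comm, ← sq, h2, div_eq_one_iff_eq two_ne_zero, neg_sq] at this
  generalize (u * ((-1) ^ i * Qs (-k * u ^ 2) i)) = X at *
  rw [neg_mul] at this
  generalize (v * Qs (l * v ^ 2) i) = Y at *
  have t : (k : ℝ) * X ^ 2 - l * Y ^ 2 = 2 := by
    push_cast at this
    linear_combination this - X ^ 2 * hk2 + Y ^ 2 * hl2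
  exact_mod_cast t

lemma structure_thm (k l : ℕ) (hk : 0 < k) (hl : 0 < l) (hok : Odd k)
    (x₁ y₁ : ℕ) (hx₁ : 0 < x₁) (hy₁ : 0 < y₁)
    (hsol₁ : (k : ℤ) * (x₁ : ℤ) ^ 2 - (l : ℤ) * (y₁ : ℤ) ^ 2 = 2)
    (hmin : ∀ u v : ℕ, 0 < u → 0 < v →
      (k : ℤ) * (u : ℤ) ^ 2 - (l : ℤ) * (v : ℤ) ^ 2 = 2 →
      (x₁ : ℝ) * Real.sqrt k + (y₁ : ℝ) * Real.sqrt l ≤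
        (u : ℝ) * Real.sqrt k + (v : ℝ) * Real.sqrt l) :
    ∀ y x : ℕ, 0 < x → 0 < y → (k : ℤ) * (x : ℤ) ^ 2 - (l : ℤ) * (y : ℤ) ^ 2 = 2 →
      ∃ i : ℕ, ((x : ℝ) * √k + y * √l) / √2 = (((x₁ : ℝ) * √k + y₁ * √l) / √2) ^ (2 * i + 1) := by
  intro y
  induction y using Nat.strong_induction_on with
  | _ y ih =>
  intro x hx hy hsol
  have hk2 : √(k : ℝ) ^ 2 = k := Real.sq_sqrt (by positivity)
  have hl2 : √(l : ℝ) ^ 2 = l := Real.sq_sqrt (by positivity)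
  have h2 : √(2 : ℝ) ^ 2 = 2 := Real.sq_sqrt (by positivity)
  have h20 : √(2 : ℝ) ≠ 0 := by positivity
  rcases (hmin x y hx hy hsol).eq_or_lt with heq | hlt
  · exact ⟨0, by rw [heq]; simp⟩
  have hx₁' : (0 : ℤ) < x₁ := by exact_mod_cast hx₁
  have hy₁' : (0 : ℤ) < y₁ := by exact_mod_cast hy₁
  have hx' : (0 : ℤ) < x := by exact_mod_cast hx
  have hy' : (0 : ℤ) < y := by exact_mod_cast hy
  have hk' : (0 : ℤ) < k := by exact_mod_cast hk
  have hl' : (0 : ℤ) < l := by exact_mod_cast hl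
  obtain ⟨a, ha⟩ : ∃ a : ℤ, a = k * x₁ ^ 2 - 1 := ⟨_, rfl⟩
  obtain ⟨b, hb⟩ : ∃ b : ℤ, b = x₁ * y₁ := ⟨_, rfl⟩
  have hb1 : 0 < b := by rw [hb]; positivity
  have ha1 : 2 ≤ a := by
    have : 0 < (l : ℤ) * (y₁ : ℤ) ^ 2 := by positivity
    linarith
  have hab : a ^ 2 - k * l * b ^ 2 = 1 := by
    rw [ha, hb]; linear_combination (k * x₁ ^ 2 : ℤ) * hsol₁
  obtain ⟨X, hX⟩ : ∃ X : ℤ, X = x * a - y * l * b := ⟨_, rfl⟩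
  obtain ⟨Y, hY⟩ : ∃ Y : ℤ, Y = y * a - x * k * b := ⟨_, rfl⟩
  have hXY : (k : ℤ) * X ^ 2 - l * Y ^ 2 = 2 := by
    rw [hX, hY]; linear_combination (a ^ 2 - k * l * b ^ 2) * hsol + 2 * hab
  have hXpos : 0 < X := by
    rw [hX, sub_pos]
    apply lt_of_pow_lt_pow_left₀ 2 (by positivity)
    have : k * (y * l * b) ^ 2 < k * (x * a) ^ 2 := by
      have e : (k : ℤ) * (x * a) ^ 2 - k * (y * l * b) ^ 2 = 2 * a ^ 2 + l * y ^ 2 := by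
        linear_combination a ^ 2 * hsol + (l * y ^ 2) * hab
      have : 0 < 2 * a ^ 2 + (l : ℤ) * y ^ 2 := by positivity
      linarith
    exact lt_of_mul_lt_mul_left this hk'.le
  have haR : (a : ℝ) = k * x₁ ^ 2 - 1 := by rw [ha]; push_cast; ring
  have hbR : (b : ℝ) = x₁ * y₁ := by rw [hb]; push_cast; ring
  have hXR : (X : ℝ) = x * a - y * l * b := by rw [hX]; push_cast; ring
  have hYR : (Y : ℝ) = y * a - x * k * b := by rw [hY]; push_cast; ring
  have hsolR : (k : ℝ) * (x : ℝ) ^ 2 - l * (y : ℝ) ^ 2 = 2 := by exact_mod_cast hsol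
  have hsol₁R : (k : ℝ) * (x₁ : ℝ) ^ 2 - l * (y₁ : ℝ) ^ 2 = 2 := by exact_mod_cast hsol₁
  have habR : (a : ℝ) ^ 2 - k * l * b ^ 2 = 1 := by exact_mod_cast hab
  have heps : ((x₁ : ℝ) * √k + y₁ * √l) ^ 2 = 2 * a + 2 * b * (√k * √l) := by
    rw [haR, hbR]; linear_combination x₁ ^ 2 * hk2 + y₁ ^ 2 * hl2 - hsol₁R
  have hepos : 0 < (x₁ : ℝ) * √k + y₁ * √l := by positivity
  rcases lt_trichotomy Y 0 with hY0 | hY0 | hY0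
  · exfalso
    have h1 := hmin X.toNat (-Y).toNat (by omega) (by omega) (by
      rw [Int.toNat_of_nonneg hXpos.le, Int.toNat_of_nonneg (by omega), neg_sq]; exact hXY)
    have c1 : ((X.toNat : ℕ) : ℝ) = X := by
      have := Int.toNat_of_nonneg hXpos.le
      exact_mod_cast congrArg (Int.cast : ℤ → ℝ) this
    have c2 : (((-Y).toNat : ℕ) : ℝ) = -Y := by
      have := Int.toNat_of_nonneg (show 0 ≤ -Y by omega)
      exact_mod_cast congrArg (Int.cast : ℤ → ℝ) this
    rw [c1, c2] at h1
    have prod : ((x : ℝ) * √k + y * √l) * (X * √k + -Y * √l) =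
        ((x₁ : ℝ) * √k + y₁ * √l) ^ 2 := by
      rw [heps, hXR, hYR]
      linear_combination (x * (x * a - y * l * b)) * hk2 - (y * (y * a - x * k * b)) * hl2 +
        (a + b * (√k * √l)) * hsolR
    nlinarith
  · exfalso
    rw [hY0] at hXY
    have hd : (k : ℤ) ∣ 2 := ⟨X ^ 2, by linarith⟩
    have hd' : k ∣ 2 := by exact_mod_cast hd
    have := Nat.le_of_dvd (by norm_num) hd'
    obtain ⟨r, hr⟩ := hok
    have hk1 : k = 1 := by omega
    rw [hk1] at hXY; norm_num at hXY
    have hX2 : X < 2 := by nlinarith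
    have : X = 1 := by omega
    rw [this] at hXY; norm_num at hXY
  · have hyY : (y : ℤ) = Y * a + X * k * b := by
      rw [hX, hY]; linear_combination -(y : ℤ) * hab
    have hYy : Y < y := by
      have : 0 < X * k * b := by positivity
      nlinarith
    obtain ⟨i, hi⟩ := ih Y.toNat (by omega) X.toNat (by omega) (by omega) (by
      rw [Int.toNat_of_nonneg hXpos.le, Int.toNat_of_nonneg (by omega)]; exact hXY)
    have c1 : ((X.toNat : ℕ) : ℝ) = X := by
      have := Int.toNat_of_nonneg hXpos.le
      exact_mod_cast congrArg (Int.cast : ℤ → ℝ) this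
    have c2 : ((Y.toNat : ℕ) : ℝ) = Y := by
      have := Int.toNat_of_nonneg (show 0 ≤ Y by omega)
      exact_mod_cast congrArg (Int.cast : ℤ → ℝ) this
    rw [c1, c2] at hi
    refine ⟨i + 1, ?_⟩
    rw [show 2 * (i + 1) + 1 = (2 * i + 1) + 2 by ring, pow_add, ← hi, div_pow _ _ 2, h2, heps,
      div_mul_eq_mul_div]
    congr 1
    rw [hXR, hYR]
    linear_combination (-(x : ℝ) * √k - y * √l) * habR -
      (y * a - x * k * b) * b * √k * hl2 - (x * a - y * l * b) * b * √l * hk2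

/-- Luo's extension of Störmer's theorem for `k x² - l y² = 2` with `k, l` odd. -/
theorem stormer_kl_two (k l : ℕ) (hk : 0 < k) (hl : 0 < l)
    (hok : Odd k) (hol : Odd l)
    (hco : Nat.Coprime k l) (hns : ¬ IsSquare (k * l))
    (x₁ y₁ : ℕ) (hx₁ : 0 < x₁) (hy₁ : 0 < y₁)
    (hsol₁ : (k : ℤ) * (x₁ : ℤ) ^ 2 - (l : ℤ) * (y₁ : ℤ) ^ 2 = 2)
    (hmin : ∀ u v : ℕ, 0 < u → 0 < v →
      (k : ℤ) * (u : ℤ) ^ 2 - (l : ℤ) * (v : ℤ) ^ 2 = 2 →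
      (x₁ : ℝ) * Real.sqrt k + (y₁ : ℝ) * Real.sqrt l ≤
        (u : ℝ) * Real.sqrt k + (v : ℝ) * Real.sqrt l)
    (x y : ℕ) (hx : 0 < x) (hy : 0 < y)
    (hsol : (k : ℤ) * (x : ℤ) ^ 2 - (l : ℤ) * (y : ℤ) ^ 2 = 2) :
    ((∀ p : ℕ, p.Prime → p ∣ x → p ∣ k) →
      ((x : ℝ) * Real.sqrt k + (y : ℝ) * Real.sqrt l =
          (x₁ : ℝ) * Real.sqrt k + (y₁ : ℝ) * Real.sqrt l ∨
        (((x : ℝ) * Real.sqrt k + (y : ℝ) * Real.sqrt l) / Real.sqrt 2 =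
            (((x₁ : ℝ) * Real.sqrt k + (y₁ : ℝ) * Real.sqrt l) / Real.sqrt 2) ^ 3 ∧
          ∃ s : ℕ, 0 < s ∧ x = 3 ^ s * x₁ ∧ ¬ (3 ∣ x₁) ∧
            3 ^ s + 3 = 2 * k * x₁ ^ 2))) ∧
    ((∀ p : ℕ, p.Prime → p ∣ y → p ∣ l) →
      ((x : ℝ) * Real.sqrt k + (y : ℝ) * Real.sqrt l =
          (x₁ : ℝ) * Real.sqrt k + (y₁ : ℝ) * Real.sqrt l ∨
        (((x : ℝ) * Real.sqrt k + (y : ℝ) * Real.sqrt l) / Real.sqrt 2 =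
            (((x₁ : ℝ) * Real.sqrt k + (y₁ : ℝ) * Real.sqrt l) / Real.sqrt 2) ^ 3 ∧
          ∃ s : ℕ, 0 < s ∧ y = 3 ^ s * y₁ ∧ ¬ (3 ∣ y₁) ∧
            3 ^ s = 2 * l * y₁ ^ 2 + 3))) := by
  have hk2 : (0 : ℤ) < k := by exact_mod_cast hk
  have hl2 : (0 : ℤ) < l := by exact_mod_cast hl
  have hx₁' : (0 : ℤ) < x₁ := by exact_mod_cast hx₁
  have hy₁' : (0 : ℤ) < y₁ := by exact_mod_cast hy₁
  have h20 : √(2 : ℝ) ≠ 0 := by positivity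
  obtain ⟨j, hj⟩ := structure_thm k l hk hl hok x₁ y₁ hx₁ hy₁ hsol₁ hmin y x hx hy hsol
  obtain ⟨A, hA⟩ : ∃ A : ℕ → ℤ, ∀ i, A i = (x₁ : ℤ) * ((-1) ^ i * Qs (-k * (x₁ : ℤ) ^ 2) i) :=
    ⟨_, fun _ => rfl⟩
  obtain ⟨B, hB⟩ : ∃ B : ℕ → ℤ, ∀ i, B i = (y₁ : ℤ) * Qs (l * (y₁ : ℤ) ^ 2) i :=
    ⟨_, fun _ => rfl⟩
  have hpow : ∀ i, (((x₁ : ℝ) * √k + y₁ * √l) / √2) ^ (2 * i + 1) =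
      ((A i : ℝ) * √k + B i * √l) / √2 := by
    intro i
    have := powers k l x₁ y₁ hsol₁ i
    rw [← hA, ← hB] at this
    exact_mod_cast this
  have hnorm : ∀ i, (k : ℤ) * A i ^ 2 - l * B i ^ 2 = 2 := by
    intro i
    have := powers_norm k l x₁ y₁ hsol₁ i
    rwa [← hA, ← hB] at this
  have hxy : (x : ℤ) = A j ∧ (y : ℤ) = B j := by
    apply uniq k l hk hl _ _ _ _ hsol (hnorm j)
    rw [hpow, div_left_inj' h20] at hj
    exact_mod_cast hj
  have hcomp : ∀ m i j, 2 * j + 1 = (2 * m + 1) * (2 * i + 1) →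
      A j = A m * ((-1) ^ i * Qs (-k * A m ^ 2) i) ∧ B j = B m * Qs (l * B m ^ 2) i := by
    intro m i j h
    apply uniq k l hk hl _ _ _ _ (hnorm j) (powers_norm k l _ _ (hnorm m) i)
    have h1 := hpow j
    rw [h, pow_mul, hpow m, powers k l _ _ (hnorm m) i, div_left_inj' h20] at h1
    exact h1.symm
  have hBne : ∀ m, B m ≠ 0 := by
    intro m
    rw [hB]
    refine mul_ne_zero hy₁'.ne' ?_
    rcases m with _ | m
    · simp [Qs_zero]
    · have hpos : 0 < (l : ℤ) * (y₁ : ℤ) ^ 2 := by positivity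
      have := (Qs_growth (l * (y₁ : ℤ) ^ 2) (Or.inl hpos) m).1
      intro h0
      rw [h0, abs_zero] at this
      linarith [(by positivity : (0 : ℤ) ≤ m)]
  have hBpos : ∀ m, 1 ≤ (l : ℤ) * B m ^ 2 := by
    intro m
    have : 0 < B m ^ 2 := by have := hBne m; positivity
    exact Int.add_one_le_iff.2 (mul_pos hl2 this)
  have hred : j = 0 → (x : ℝ) * √k + (y : ℝ) * √l = (x₁ : ℝ) * √k + (y₁ : ℝ) * √l := by
    intro h
    rw [h] at hj
    simpa [div_left_inj' h20] using hj
  constructor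
  · intro hp
    rcases Nat.eq_zero_or_pos j with h0 | hjpos
    · exact Or.inl (hred h0)
    right
    obtain ⟨hj1, s, hs, hs2, hs3⟩ := dio (-k) x₁ A
      (fun m => by rw [hA]; simp [abs_mul])
      (fun m => Or.inr (by linarith [hnorm m, hBpos m]))
      (fun m i j h => by rw [(hcomp m i j h).1]; simp [abs_mul]) j hjpos
      (fun q hq hd => by
        rw [← hxy.1] at hd
        rw [dvd_neg]
        exact_mod_cast hp q hq (by exact_mod_cast hd))
    subst hj1
    refine ⟨hj, s, hs, ?_⟩
    have hge := hBpos 0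
    have hge0 : 1 ≤ (l : ℤ) * (y₁ : ℤ) ^ 2 := by simpa [hB, Qs_zero] using hge
    rw [Qs_one, abs_of_nonpos (by linarith)] at hs2
    have hx2 := hxy.1
    rw [hA, Qs_one] at hx2
    refine ⟨?_, by exact_mod_cast hs3, ?_⟩
    · have : (x : ℤ) = 3 ^ s * x₁ := by rw [hx2, ← hs2]; ring
      exact_mod_cast this
    · have : (3 : ℤ) ^ s + 3 = 2 * k * x₁ ^ 2 := by rw [← hs2]; ring
      exact_mod_cast this
  · intro hp
    rcases Nat.eq_zero_or_pos j with h0 | hjpos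
    · exact Or.inl (hred h0)
    right
    obtain ⟨hj1, s, hs, hs2, hs3⟩ := dio l y₁ B
      (fun m => by rw [hB])
      (fun m => Or.inl (hBpos m))
      (fun m i j h => by rw [(hcomp m i j h).2]) j hjpos
      (fun q hq hd => by
        rw [← hxy.2] at hd
        exact_mod_cast hp q hq (by exact_mod_cast hd))
    subst hj1
    refine ⟨hj, s, hs, ?_⟩
    have hge := hBpos 0
    have hge0 : 1 ≤ (l : ℤ) * (y₁ : ℤ) ^ 2 := by simpa [hB, Qs_zero] using hge
    rw [Qs_one, abs_of_nonneg (by linarith)] at hs2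
    have hx2 := hxy.2
    rw [hB, Qs_one] at hx2
    refine ⟨?_, by exact_mod_cast hs3, ?_⟩
    · have : (y : ℤ) = 3 ^ s * y₁ := by rw [hx2, ← hs2]; ring
      exact_mod_cast this
    · have : (3 : ℤ) ^ s = 2 * l * y₁ ^ 2 + 3 := by rw [← hs2]; ring
      exact_mod_cast this
end

section
/- Let k, l be coprime odd positive integers with k > 1 and kl nonsquare, such that k x² − l y² = 4 has a solution in odd positive integers, and let (x, y) be a positive integer solution of k x² − l y² = 4. (i) If every prime divisor of x divides k, then (x, y) is the minimal positive solution of k x² − l y² = 4, except in the case (k, l, x, y) = (5, 1, 5, 11). (ii) If every prime divisor of y divides l, then (x, y) is the minimal positive solution of k x² − l y² = 4. -/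
namespace StormerAux

/-- Lucas-type sequence. -/
def g (T c : ℤ) : ℕ → ℤ
  | 0 => 1
  | 1 => T + c
  | (j+2) => T * g T c (j+1) - g T c j

lemma g_two (T c : ℤ) (j : ℕ) : g T c (j+2) = T * g T c (j+1) - g T c j := rfl

lemma g_r_cong (D : ℤ) (j : ℕ) :
    (∃ c, g (D+2) 1 j = (2*j+1) + D * c) ∧ (∃ c, g (D+2) 1 (j+1) = (2*j+3) + D * c) := by
  induction j with
  | zero => exact ⟨⟨0, by simp [g]⟩, ⟨1, by simp [g]; ring⟩⟩
  | succ j ih =>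
    obtain ⟨⟨c, hc⟩, ⟨d, hd⟩⟩ := ih
    refine ⟨⟨d, by rw [hd]; push_cast; ring⟩, ⟨(2*j+3) + (D+2)*d - c, ?_⟩⟩
    rw [g_two, hc, hd]; push_cast; ring

lemma g_r_cong2 (D : ℤ) (j : ℕ) :
    (∃ c, 6 * g (D+2) 1 j = 6*(2*j+1) + j*(j+1)*(2*j+1)*D + D^2 * c) ∧
    (∃ c, 6 * g (D+2) 1 (j+1) = 6*(2*j+3) + (j+1)*(j+2)*(2*j+3)*D + D^2 * c) := by
  induction j with
  | zero => exact ⟨⟨0, by simp [g]⟩, ⟨0, by simp [g]; ring⟩⟩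
  | succ j ih =>
    obtain ⟨⟨c, hc⟩, ⟨d, hd⟩⟩ := ih
    refine ⟨⟨d, by rw [hd]; push_cast; ring⟩, ⟨(j+1)*(j+2)*(2*j+3) + (D+2)*d - c, ?_⟩⟩
    have : 6 * g (D+2) 1 (j+1+1) = (D+2) * (6 * g (D+2) 1 (j+1)) - 6 * g (D+2) 1 j := by
      rw [g_two]; ring
    rw [this, hc, hd]; push_cast; ring

lemma g_q (S : ℤ) (j : ℕ) :
    g (S-2) (-1) j = (-1)^j * g (-S+2) 1 j ∧
    g (S-2) (-1) (j+1) = (-1)^(j+1) * g (-S+2) 1 (j+1) := by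
  induction j with
  | zero => constructor <;> simp [g] ; ring
  | succ j ih =>
    refine ⟨ih.2, ?_⟩
    rw [g_two, g_two, ih.1, ih.2]; ring

lemma g_r_bound (T : ℤ) (hT : 3 ≤ T) (j : ℕ) :
    1 + 3 * (j:ℤ) ≤ g T 1 j ∧ g T 1 j + 3 ≤ g T 1 (j+1) := by
  induction j with
  | zero => constructor <;> simp [g]; linarith
  | succ j ih =>
    obtain ⟨h1, h2⟩ := ih
    refine ⟨by push_cast; linarith, ?_⟩
    rw [g_two]
    nlinarith [mul_nonneg (sub_nonneg.2 hT) (by linarith [Int.natCast_nonneg j] : 0 ≤ g T 1 (j+1))]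

lemma g_q_bound (T : ℤ) (hT : 3 ≤ T) (j : ℕ) :
    5 + 5 * (j:ℤ) ≤ g T (-1) (j+2) ∧ g T (-1) (j+2) + 5 ≤ g T (-1) (j+3) := by
  induction j with
  | zero =>
    have e2 : g T (-1) 2 = T * (T + -1) - 1 := rfl
    have e3 : g T (-1) 3 = T * (T * (T + -1) - 1) - (T + -1) := rfl
    have h : 5 ≤ g T (-1) 2 := by rw [e2]; nlinarith
    refine ⟨by simpa using h, ?_⟩
    simp only [zero_add]
    rw [e2] at h
    rw [e3, e2]
    nlinarith [mul_nonneg (sub_nonneg.2 hT) (sub_nonneg.2 h)]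
  | succ j ih =>
    obtain ⟨h1, h2⟩ := ih
    have h3 : 5 + 5 * ((j+1:ℕ):ℤ) ≤ g T (-1) (j+1+2) := by push_cast; linarith
    refine ⟨h3, ?_⟩
    have : g T (-1) (j+1+3) = T * g T (-1) (j+3) - g T (-1) (j+2) := rfl
    rw [this]
    rw [show j+1+2 = j+3 from rfl] at *
    nlinarith [mul_nonneg (sub_nonneg.2 hT) (by linarith [Int.natCast_nonneg j] : 0 ≤ g T (-1) (j+3))]

/-- The real number attached to a solution. -/
noncomputable def phi (k l : ℕ) (x y : ℤ) : ℝ := (x * √(k:ℝ) + y * √(l:ℝ)) / 2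

lemma phi_conj {k l : ℕ} {x y : ℤ} : phi k l x y * phi k l x (-y) = ((k * x^2 - l * y^2 : ℤ) : ℝ) / 4 := by
  have hK : √(k:ℝ)^2 = k := Real.sq_sqrt (by positivity)
  have hL : √(l:ℝ)^2 = l := Real.sq_sqrt (by positivity)
  unfold phi; push_cast
  linear_combination (x^2/4:ℝ) * hK - (y^2/4:ℝ) * hL

lemma phi_pow (k l : ℕ) (a b : ℤ) (h : (k:ℤ) * a^2 - l * b^2 = 4) (j : ℕ) :
    phi k l (a * g (k*a^2-2) (-1) j) (b * g (k*a^2-2) 1 j) = phi k l a b ^ (2*j+1) ∧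
    phi k l (a * g (k*a^2-2) (-1) (j+1)) (b * g (k*a^2-2) 1 (j+1)) = phi k l a b ^ (2*j+3) := by
  have hK : √(k:ℝ)^2 = k := Real.sq_sqrt (by positivity)
  have hL : √(l:ℝ)^2 = l := Real.sq_sqrt (by positivity)
  have hR : (k:ℝ) * a^2 - l * b^2 = 4 := by exact_mod_cast h
  have hc : phi k l a b * phi k l a (-b) = 1 := by rw [phi_conj, h]; norm_num
  have hs : phi k l a b + phi k l a (-b) = a * √(k:ℝ) := by unfold phi; push_cast; ring
  have h4 : phi k l a b ^ 4 = (k*a^2-2) * phi k l a b ^ 2 - 1 := by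
    set P := phi k l a b
    set Q := phi k l a (-b)
    have e : (k:ℝ)*a^2 = (P+Q)^2 := by rw [hs, mul_pow, hK]; ring
    rw [e]
    linear_combination (-2 * P^2 - P*Q-1) * hc
  induction j with
  | zero =>
    refine ⟨by simp [g], ?_⟩
    simp only [g, zero_add, mul_zero]
    unfold phi; push_cast
    set K := √(k:ℝ)
    set L := √(l:ℝ)
    rw [← hK] at hR ⊢
    rw [← hL] at hR
    linear_combination ((3*a*K/8+b*L/8):ℝ) * hR
  | succ j ih =>
    refine ⟨ih.2, ?_⟩
    have e : phi k l a b ^ (2*(j+1)+3) = (k*a^2-2) * phi k l a b ^ (2*j+3) - phi k l a b ^ (2*j+1) := by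
      have : phi k l a b ^ (2*(j+1)+3) = phi k l a b ^ 4 * phi k l a b ^ (2*j+1) := by ring
      rw [this, h4]; ring
    rw [e, ← ih.1, ← ih.2, g_two, g_two]
    unfold phi; push_cast; ring

lemma phi_inj {k l : ℕ} (hk : 0 < k) (hl : 0 < l) {x y a b : ℤ}
    (h : (k:ℤ) * x^2 - l * y^2 = 4) (h' : (k:ℤ) * a^2 - l * b^2 = 4)
    (e : phi k l x y = phi k l a b) : x = a ∧ y = b := by
  have hc : phi k l x y * phi k l x (-y) = 1 := by rw [phi_conj, h]; norm_num
  have hc' : phi k l a b * phi k l a (-b) = 1 := by rw [phi_conj, h']; norm_num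
  have e2 : phi k l x (-y) = phi k l a (-b) := by
    rw [e] at hc
    exact mul_left_cancel₀ (left_ne_zero_of_mul_eq_one hc) (hc.trans hc'.symm)
  have hK : 0 < √(k:ℝ) := Real.sqrt_pos.2 (by exact_mod_cast hk)
  have hL : 0 < √(l:ℝ) := Real.sqrt_pos.2 (by exact_mod_cast hl)
  unfold phi at e e2
  push_cast at e e2
  have e3 : (x:ℝ) * √(k:ℝ) = a * √(k:ℝ) := by linarith
  have e4 : (y:ℝ) * √(l:ℝ) = b * √(l:ℝ) := by linarith
  exact ⟨by exact_mod_cast mul_right_cancel₀ hK.ne' e3, by exact_mod_cast mul_right_cancel₀ hL.ne' e4⟩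

/-- powers of solutions are solutions -/
lemma pow_sol {k l : ℕ} {a b : ℤ} (h : (k:ℤ) * a^2 - l * b^2 = 4) (j : ℕ) :
    (k:ℤ) * (a * g (k*a^2-2) (-1) j)^2 - l * (b * g (k*a^2-2) 1 j)^2 = 4 := by
  have hc : phi k l a b * phi k l a (-b) = 1 := by rw [phi_conj, h]; norm_num
  have h1 := (phi_pow k l a b h j).1
  have h2 := (phi_pow k l a (-b) (by simpa using h) j).1
  rw [neg_mul] at h2
  have := @phi_conj k l (a * g (k*a^2-2) (-1) j) (b * g (k*a^2-2) 1 j)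
  rw [h1, h2, ← mul_pow, hc, one_pow] at this
  have h3 : (((k:ℤ) * (a * g (k*a^2-2) (-1) j)^2 - l * (b * g (k*a^2-2) 1 j)^2 : ℤ):ℝ) = 4 := by linarith
  exact_mod_cast h3

lemma sol_T {k l : ℕ} (hl : 0 < l) {a b : ℤ} (hb : 0 < b) (h : (k:ℤ) * a^2 - l * b^2 = 4) :
    3 ≤ (k:ℤ)*a^2-2 := by
  have : 0 < (l:ℤ) * b^2 := by positivity
  linarith

lemma g_r_pos (T : ℤ) (hT : 3 ≤ T) (j : ℕ) : 0 < g T 1 j := by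
  have := (g_r_bound T hT j).1
  linarith [Int.natCast_nonneg j]

lemma g_q_pos (T : ℤ) (hT : 3 ≤ T) : ∀ j : ℕ, 0 < g T (-1) j
  | 0 => by simp [g]
  | 1 => by simp only [g]; linarith
  | (j+2) => by
    have := (g_q_bound T hT j).1
    linarith [Int.natCast_nonneg j]

lemma phi_gt_one {k l : ℕ} (hl : 0 < l) {x y : ℤ} (hx : 0 < x) (hy : 0 < y)
    (h : (k:ℤ) * x^2 - l * y^2 = 4) : 1 < phi k l x y := by
  have hc : phi k l x y * phi k l x (-y) = 1 := by rw [phi_conj, h]; norm_num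
  have hL : 0 < √(l:ℝ) := Real.sqrt_pos.2 (by exact_mod_cast hl)
  have hlt : phi k l x (-y) < phi k l x y := by
    unfold phi; push_cast
    have : (0:ℝ) < y := by exact_mod_cast hy
    have := mul_pos this hL
    linarith
  have hp : 0 < phi k l x y := by
    unfold phi
    have h1 : (0:ℝ) < y := by exact_mod_cast hy
    have h2 : (0:ℝ) < x := by exact_mod_cast hx
    positivity
  by_contra hle
  push Not at hle
  nlinarith

/-- solutions with phi > 1 are positive -/
lemma pos_of_phi {k l : ℕ} {x y : ℤ}
    (h : (k:ℤ) * x^2 - l * y^2 = 4) (hp : 1 < phi k l x y) : 0 < x ∧ 0 < y := by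
  have hc : phi k l x y * phi k l x (-y) = 1 := by rw [phi_conj, h]; norm_num
  have hK : 0 ≤ √(k:ℝ) := Real.sqrt_nonneg _
  have hL : 0 ≤ √(l:ℝ) := Real.sqrt_nonneg _
  set P := phi k l x y with hP
  set Q := phi k l x (-y) with hQ
  have hQp : 0 < Q := by
    by_contra hh
    push Not at hh
    nlinarith
  have hQ1 : Q < 1 := by nlinarith
  have e1 : (x:ℝ) * √(k:ℝ) = P + Q := by rw [hP, hQ]; unfold phi; push_cast; ring
  have e2 : (y:ℝ) * √(l:ℝ) = P - Q := by rw [hP, hQ]; unfold phi; push_cast; ring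
  constructor
  · have : (0:ℝ) < x := pos_of_mul_pos_left (by rw [e1]; linarith) hK
    exact_mod_cast this
  · have : (0:ℝ) < y := pos_of_mul_pos_left (by rw [e2]; linarith) hL
    exact_mod_cast this

lemma y_le_of_x_le {k l : ℕ} (hl : 0 < l) {x y a b : ℤ} (hx : 0 < x) (hb : 0 < b)
    (h : (k:ℤ) * x^2 - l * y^2 = 4) (h' : (k:ℤ) * a^2 - l * b^2 = 4) (hxa : x ≤ a) : y ≤ b := by
  have h1 : x^2 ≤ a^2 := pow_le_pow_left₀ hx.le hxa 2
  have h2 : (k:ℤ) * x^2 ≤ k * a^2 := mul_le_mul_of_nonneg_left h1 (by positivity)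
  have h3 : (l:ℤ) * y^2 ≤ l * b^2 := by linarith
  have h4 : y^2 ≤ b^2 := le_of_mul_le_mul_left h3 (by exact_mod_cast hl)
  exact (abs_le_of_sq_le_sq' h4 hb.le).2

lemma phi_le {k l : ℕ} {x y a b : ℤ} (hxa : x ≤ a) (hyb : y ≤ b) : phi k l x y ≤ phi k l a b := by
  have hK : 0 ≤ √(k:ℝ) := Real.sqrt_nonneg _
  have hL : 0 ≤ √(l:ℝ) := Real.sqrt_nonneg _
  have h1 : (x:ℝ) ≤ a := by exact_mod_cast hxa
  have h2 : (y:ℝ) ≤ b := by exact_mod_cast hyb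
  unfold phi
  gcongr

/-- one descent step -/
lemma descent_step {k l : ℕ} (hok : Odd k) (hol : Odd l) {x y a b : ℤ}
    (h : (k:ℤ) * x^2 - l * y^2 = 4) (h' : (k:ℤ) * a^2 - l * b^2 = 4) :
    ∃ x' y' : ℤ, (k:ℤ) * x'^2 - l * y'^2 = 4 ∧ phi k l x' y' * phi k l a b ^ 2 = phi k l x y := by
  have par : ∀ {x y : ℤ}, (k:ℤ) * x^2 - l * y^2 = 4 → (Even x ↔ Even y) := by
    intro x y h
    have h1 : Even ((k:ℤ) * x^2 - l * y^2) := by rw [h]; decide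
    have hk' : ¬ Even (k:ℤ) := by rw [Int.not_even_iff_odd]; exact_mod_cast hok
    have hl' : ¬ Even (l:ℤ) := by rw [Int.not_even_iff_odd]; exact_mod_cast hol
    simpa [Int.even_sub, Int.even_mul, Int.even_pow, hk', hl'] using h1
  have p1 := par h
  have p2 := par h'
  have hk' : ¬ Even (k:ℤ) := by rw [Int.not_even_iff_odd]; exact_mod_cast hok
  have hl' : ¬ Even (l:ℤ) := by rw [Int.not_even_iff_odd]; exact_mod_cast hol
  have e1 : Even (x * (k*a^2-2) - l*a*b*y) := by
    simp [Int.even_sub, Int.even_mul, Int.even_pow, hk', hl']; tauto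
  have e2 : Even (y * (k*a^2-2) - k*a*b*x) := by
    simp [Int.even_sub, Int.even_mul, Int.even_pow, hk', hl']; tauto
  obtain ⟨x', hx'⟩ := e1.two_dvd
  obtain ⟨y', hy'⟩ := e2.two_dvd
  have hK : √(k:ℝ)^2 = k := Real.sq_sqrt (by positivity)
  have hL : √(l:ℝ)^2 = l := Real.sq_sqrt (by positivity)
  have hR : (k:ℝ) * a^2 - l * b^2 = 4 := by exact_mod_cast h'
  refine ⟨x', y', ?_, ?_⟩
  · have : (4:ℤ) * (k * x'^2 - l * y'^2) = 4 * 4 := by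
      have : (4:ℤ) * (k * x'^2 - l * y'^2) = k * (2*x')^2 - l * (2*y')^2 := by ring
      rw [this, ← hx', ← hy']
      have : (k:ℤ) * (x * (k*a^2-2) - l*a*b*y)^2 - l * (y * (k*a^2-2) - k*a*b*x)^2
        = (k*x^2-l*y^2) * ((k*a^2-2)^2 - (k * a^2) * (l*b^2)) := by ring
      rw [this, h, show (l:ℤ)*b^2 = k*a^2-4 by linarith]; ring
    linarith
  · have hx2 : (x':ℝ) = (x * (k*a^2-2) - l*a*b*y)/2 := by
      have : (x:ℝ) * (k*a^2-2) - l*a*b*y = 2 * x' := by exact_mod_cast hx'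
      linarith
    have hy2 : (y':ℝ) = (y * (k*a^2-2) - k*a*b*x)/2 := by
      have : (y:ℝ) * (k*a^2-2) - k*a*b*x = 2 * y' := by exact_mod_cast hy'
      linarith
    have hc : phi k l a b * phi k l a (-b) = 1 := by rw [phi_conj, h']; norm_num
    have e : phi k l x' y' = phi k l x y * phi k l a (-b) ^ 2 := by
      unfold phi
      rw [hx2, hy2]; push_cast
      set K := √(k:ℝ)
      set L := √(l:ℝ)
      rw [← hK, ← hL] at hR ⊢
      linear_combination ((x*K+y*L)/8:ℝ) * hR
    rw [e, mul_assoc, ← mul_pow, mul_comm (phi k l a (-b)), hc]; ring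

lemma descent {k l : ℕ} (hk : 1 < k) (hl : 0 < l) (hok : Odd k) (hol : Odd l) {a b : ℤ}
    (ha : 0 < a) (hb : 0 < b) (h' : (k:ℤ) * a^2 - l * b^2 = 4)
    (hmin : ∀ u v : ℤ, 0 < u → 0 < v → (k:ℤ) * u^2 - l * v^2 = 4 → a ≤ u) (n : ℕ) :
    ∀ x y : ℤ, 0 < x → 0 < y → (k:ℤ) * x^2 - l * y^2 = 4 → x < n →
      ∃ j : ℕ, phi k l x y = phi k l a b ^ (2*j+1) := by
  have h1 := phi_gt_one hl ha hb h'
  have hminphi : ∀ u v : ℤ, 0 < u → 0 < v → (k:ℤ) * u^2 - l * v^2 = 4 →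
      phi k l a b ≤ phi k l u v := by
    intro u v hu hv h
    have := hmin u v hu hv h
    exact phi_le this (y_le_of_x_le hl ha hv h' h this)
  induction n with
  | zero => intro x y hx _ _ hn; simp at hn; omega
  | succ n ih =>
    intro x y hx hy h hn
    rcases eq_or_lt_of_le (hmin x y hx hy h) with heq | hlt
    · refine ⟨0, ?_⟩
      have hle := y_le_of_x_le hl hx hb h h' heq.ge
      have hle' := y_le_of_x_le hl ha hy h' h heq.le
      rw [← heq, le_antisymm hle hle']; simp
    obtain ⟨x', y', hs, he⟩ := descent_step hok hol h h'
    have hge : phi k l a b < phi k l x y := by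
      refine lt_of_le_of_ne (hminphi x y hx hy h) ?_
      intro e
      exact hlt.ne (phi_inj (by omega) hl h' h e).1
    have hc : phi k l x' y' * phi k l x' (-y') = 1 := by rw [phi_conj, hs]; norm_num
    have hpos : 0 < phi k l x' y' := by
      by_contra hh
      push Not at hh
      nlinarith [sq_nonneg (phi k l a b)]
    rcases lt_trichotomy (phi k l x' y') 1 with hc1 | hc1 | hc1
    · exfalso
      have hq : 1 < phi k l x' (-y') := by
        by_contra hh
        push Not at hh
        nlinarith
      have hs' : (k:ℤ) * x'^2 - l * (-y')^2 = 4 := by simpa using hs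
      obtain ⟨hx', hy'⟩ := pos_of_phi hs' hq
      have hm := hminphi _ _ hx' hy' hs'
      have : phi k l x' y' * phi k l a b ≤ 1 := by nlinarith
      nlinarith
    · exfalso
      have e : phi k l x' y' = phi k l x' (-y') := by
        rw [hc1, one_mul] at hc; rw [hc1, hc]
      have hy0 := (phi_inj (by omega) hl hs (by simpa using hs) e).2
      have hy0 : y' = 0 := by omega
      rw [hy0] at hs
      have hs2 : (k:ℤ) * x'^2 = 4 := by linarith
      have hs3 : k * x'.natAbs^2 = 4 := by
        zify; rw [sq_abs]; exact hs2
      have hkd : k ∣ 4 := ⟨_, hs3.symm⟩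
      have hk4 := Nat.le_of_dvd (by norm_num) hkd
      obtain ⟨t, ht⟩ := hok
      interval_cases k <;> omega
    · obtain ⟨hx', hy'⟩ := pos_of_phi hs hc1
      have hlt2 : phi k l x' y' < phi k l x y := by
        rw [← he]
        exact lt_mul_of_one_lt_right hpos (one_lt_pow₀ h1 (by norm_num))
      have hxx : x' < x := by
        by_contra hh
        push Not at hh
        exact absurd (phi_le hh (y_le_of_x_le hl hx hy' h hs hh)) (not_le.2 hlt2)
      obtain ⟨j, hj⟩ := ih x' y' hx' hy' hs (by push_cast at hn; omega)
      refine ⟨j+1, ?_⟩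
      rw [← he, hj]; ring

/-- A nonminimal solution is a prime power of another solution. -/
lemma nonmin {k l : ℕ} (hk : 1 < k) (hl : 0 < l) (hok : Odd k) (hol : Odd l) {x y u v : ℤ}
    (hx : 0 < x) (hy : 0 < y) (h : (k:ℤ) * x^2 - l * y^2 = 4)
    (hu : 0 < u) (hv : 0 < v) (h' : (k:ℤ) * u^2 - l * v^2 = 4) (hux : u < x) :
    ∃ (a b : ℤ) (i : ℕ), 0 < a ∧ 0 < b ∧ (k:ℤ) * a^2 - l * b^2 = 4 ∧ (2*i+1).Prime ∧
      x = a * g (k*a^2-2) (-1) i ∧ y = b * g (k*a^2-2) 1 i := by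
  classical
  have hex : ∃ n : ℕ, ∃ w : ℤ, 0 < (n:ℤ) ∧ 0 < w ∧ (k:ℤ) * (n:ℤ)^2 - l * w^2 = 4 := by
    refine ⟨u.toNat, v, ?_⟩
    rw [Int.toNat_of_nonneg hu.le]; exact ⟨hu, hv, h'⟩
  obtain ⟨w, hn, hw, hs⟩ := Nat.find_spec hex
  set m := Nat.find hex with hm
  have hmin : ∀ u v : ℤ, 0 < u → 0 < v → (k:ℤ) * u^2 - l * v^2 = 4 → (m:ℤ) ≤ u := by
    intro u v hu hv h'
    have : m ≤ u.toNat := Nat.find_min' hex ⟨v, by rw [Int.toNat_of_nonneg hu.le]; exact ⟨hu, hv, h'⟩⟩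
    omega
  obtain ⟨j, hj⟩ := descent hk hl hok hol hn hw hs hmin (x.toNat+1) x y hx hy h (by omega)
  have hj0 : j ≠ 0 := by
    rintro rfl
    rw [mul_zero, zero_add, pow_one] at hj
    have := (phi_inj (by omega) hl h hs hj).1
    have := hmin u v hu hv h'
    omega
  have hpr := Nat.minFac_prime (n := 2*j+1) (by omega)
  obtain ⟨c, hc⟩ := Nat.minFac_dvd (2*j+1)
  set p := Nat.minFac (2*j+1)
  have hodd : Odd (p * c) := by rw [← hc]; exact ⟨j, rfl⟩
  obtain ⟨⟨i, hi⟩, ⟨d, hd⟩⟩ := Nat.odd_mul.1 hodd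
  have hT := sol_T hl hw hs
  have hsol := pow_sol hs d
  have hphi := (phi_pow k l _ _ hs d).1
  have ha := mul_pos hn (g_q_pos _ hT d)
  have hb := mul_pos hw (g_r_pos _ hT d)
  set a := (m:ℤ) * g (k*(m:ℤ)^2-2) (-1) d
  set b := w * g (k*(m:ℤ)^2-2) 1 d
  have hphi2 := (phi_pow k l a b hsol i).1
  have hsol2 := pow_sol hsol i
  refine ⟨a, b, i, ha, hb, hsol, by rw [← hi]; exact hpr, ?_⟩
  apply phi_inj (by omega) hl h hsol2
  rw [hphi2, hphi, hj, ← pow_mul, hc, ← hi, ← hd, mul_comm]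

/-- Extract: a positive integer congruent to `±p` mod `S` all of whose prime factors divide `S`
is a power of `p`. -/
lemma prime_pow_of {p : ℕ} (hp : p.Prime) {G S : ℤ} (hG : 1 < G)
    (hc : ∃ e c : ℤ, (e = 1 ∨ e = -1) ∧ G = e * (p + S * c))
    (hd : ∀ q : ℕ, q.Prime → (q:ℤ) ∣ G → (q:ℤ) ∣ S) :
    (p:ℤ) ∣ S ∧ ∃ s : ℕ, 1 ≤ s ∧ G = (p:ℤ)^s := by
  obtain ⟨N, rfl⟩ : ∃ N : ℕ, G = N := ⟨G.toNat, by omega⟩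
  have hN : 1 < N := by exact_mod_cast hG
  have key : ∀ q : ℕ, q.Prime → q ∣ N → q = p := by
    intro q hq hqN
    have h1 : (q:ℤ) ∣ N := by exact_mod_cast hqN
    have h2 := hd q hq h1
    obtain ⟨e, c, he, hec⟩ := hc
    have h3 : (q:ℤ) ∣ p + S * c := by
      rcases he with rfl | rfl
      · rw [one_mul] at hec; rwa [← hec]
      · have : (p:ℤ) + S * c = -N := by linarith
        rw [this]; exact h1.neg_right
    have h4 : (q:ℤ) ∣ p := (dvd_add_left (h2.mul_right c)).1 h3
    exact (Nat.prime_dvd_prime_iff_eq hq hp).1 (by exact_mod_cast h4)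
  have hpow := Nat.eq_prime_pow_of_unique_prime_dvd (n := N) (p := p) (by omega) (fun {d} a b => key d a b)
  have hpN : p ∣ N := by
    obtain ⟨q, hq, hqN⟩ := Nat.exists_prime_and_dvd (n := N) (by omega)
    rwa [← key q hq hqN]
  refine ⟨hd p hp (by exact_mod_cast hpN), N.primeFactorsList.length, ?_, by exact_mod_cast hpow⟩
  by_contra h0
  have : N.primeFactorsList.length = 0 := by omega
  rw [this] at hpow; simp at hpow; omega

/-- If moreover `p ≥ 5`, the value is exactly `p`. -/
lemma eq_p_of {p : ℕ} (hp : p.Prime) (hp5 : 5 ≤ p) {G S : ℤ} {s : ℕ} (hs : 1 ≤ s) (hG : G = (p:ℤ)^s)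
    (hpS : (p:ℤ) ∣ S)
    (hc : ∃ e c d : ℤ, (e = 1 ∨ e = -1) ∧ 6 * G = e * (6 * p + d * p * S + S^2 * c)) :
    G = p := by
  by_cases h2 : s = 1
  · rw [hG, h2, pow_one]
  exfalso
  obtain ⟨t, rfl⟩ : ∃ t, s = t + 2 := ⟨s - 2, by omega⟩
  obtain ⟨e, c, d, he, hec⟩ := hc
  obtain ⟨f, rfl⟩ := hpS
  have hpz : (p:ℤ) ≠ 0 := by exact_mod_cast hp.ne_zero
  have hee : e * e = 1 := by rcases he with rfl | rfl <;> norm_num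
  have h6 : (p:ℤ) * 6 = p * (p * (e * 6 * p^t - d * f - f^2 * c)) := by
    rw [hG] at hec
    linear_combination (-e) * hec - (6 * (p:ℤ) + d * p * (p * f) + (p*f)^2 * c) * hee
  have h7 := mul_left_cancel₀ hpz h6
  have h8 : p ∣ 6 := by
    have : (p:ℤ) ∣ (6:ℕ) := ⟨_, by exact_mod_cast h7⟩
    exact_mod_cast this
  have := Nat.le_of_dvd (by norm_num) h8
  interval_cases p <;> revert hp h8 <;> decide

lemma part1 {k l : ℕ} (hok : Odd k) (hl : 0 < l) {x y a b : ℤ} {i : ℕ}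
    (ha : 0 < a) (hb : 0 < b) (h : (k:ℤ) * a^2 - l * b^2 = 4) (hp : (2*i+1).Prime)
    (hx : x = a * g (k*a^2-2) (-1) i) (hy : y = b * g (k*a^2-2) 1 i)
    (hd : ∀ q : ℕ, q.Prime → (q:ℤ) ∣ x → q ∣ k) : k = 5 ∧ l = 1 ∧ x = 5 ∧ y = 11 := by
  have hT := sol_T hl hb h
  have hi0 : i ≠ 0 := by rintro rfl; exact absurd hp (by decide)
  set S : ℤ := k * a^2 with hS
  have hSodd : Odd S := by
    rw [hS, Int.odd_mul]
    refine ⟨by exact_mod_cast hok, Odd.pow ?_⟩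
    rw [← Int.not_even_iff_odd]
    intro he
    have : 2 ∣ k := hd 2 Nat.prime_two (by rw [hx]; exact (he.two_dvd).mul_right _)
    obtain ⟨t, ht⟩ := hok
    omega
  have hG1 : 1 < g (S-2) (-1) i := by
    match i, hi0 with
    | 1, _ => simp only [g]; linarith
    | (j+2), _ =>
      have := (g_q_bound (S-2) hT j).1
      linarith [Int.natCast_nonneg j]
  have hdS : ∀ q : ℕ, q.Prime → (q:ℤ) ∣ g (S-2) (-1) i → (q:ℤ) ∣ S := by
    intro q hq hqG
    have : q ∣ k := hd q hq (by rw [hx]; exact hqG.mul_left _)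
    exact Dvd.dvd.mul_right (by exact_mod_cast this) _
  have hsgn : ((-1:ℤ))^i = 1 ∨ ((-1:ℤ))^i = -1 := neg_one_pow_eq_or ℤ i
  obtain ⟨hpS, s, hs, hpow⟩ := prime_pow_of hp hG1
    (by
      obtain ⟨c, hc⟩ := (g_r_cong (-S) i).1
      exact ⟨(-1)^i, -c, hsgn, by rw [(g_q S i).1, hc]; push_cast; ring⟩) hdS
  by_cases h5 : 5 ≤ 2*i+1
  · have heq := eq_p_of hp h5 hs hpow hpS (by
      obtain ⟨c, hc⟩ := (g_r_cong2 (-S) i).1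
      refine ⟨(-1)^i, c, -(i*(i+1)), hsgn, ?_⟩
      rw [(g_q S i).1, mul_left_comm, hc]; push_cast; ring)
    obtain ⟨j, rfl⟩ : ∃ j, i = j + 2 := ⟨i - 2, by omega⟩
    have hbd := (g_q_bound (S-2) hT j).1
    rw [heq] at hbd
    push_cast at hbd
    have hj : j = 0 := by omega
    subst hj
    have e2 : g (S-2) (-1) 2 = (S-2) * ((S-2) + -1) - 1 := rfl
    rw [zero_add] at *
    rw [e2] at heq
    have hS5 : S = 5 := by
      push_cast at heq
      nlinarith
    have h5k : 5 ∣ k := hd 5 (by norm_num) (by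
      rw [hx, e2, hS5]; exact Dvd.intro_left a (by norm_num))
    obtain ⟨t, rfl⟩ := h5k
    have ht : (t:ℤ) * a^2 = 1 := by
      have : 5 * ((t:ℤ) * a^2) = 5 * 1 := by
        have h55 := hS.symm.trans hS5
        push_cast at h55
        linarith
      linarith
    have ht1 : (t:ℤ) = 1 := Int.eq_one_of_mul_eq_one_right (by positivity) ht
    have ha1 : a = 1 := by
      rw [ht1, one_mul] at ht
      nlinarith
    have hlb : (l:ℤ) * b^2 = 1 := by linarith
    have hl1 : (l:ℤ) = 1 := Int.eq_one_of_mul_eq_one_right (by positivity) hlb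
    have hb1 : b = 1 := by
      rw [hl1, one_mul] at hlb
      nlinarith
    have e3 : g (S-2) 1 2 = (S-2) * ((S-2) + 1) - 1 := rfl
    refine ⟨by omega, by omega, ?_, ?_⟩
    · rw [hx, e2, hS5, ha1]; norm_num
    · rw [hy, e3, hS5, hb1]; norm_num
  · exfalso
    have hi1 : i = 1 := by omega
    subst hi1
    have e1 : g (S-2) (-1) 1 = S - 3 := by simp only [g]; ring
    rw [e1] at hpow
    have ho : Odd (((2*1+1:ℕ):ℤ)^s) := Odd.pow (by decide)
    rw [← hpow] at ho
    obtain ⟨r1, hr1⟩ := ho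
    obtain ⟨r2, hr2⟩ := hSodd
    omega

lemma part2 {k l : ℕ} (hol : Odd l) (hl : 0 < l) {y a b : ℤ} {i : ℕ}
    (hb : 0 < b) (h : (k:ℤ) * a^2 - l * b^2 = 4) (hp : (2*i+1).Prime)
    (hy : y = b * g (k*a^2-2) 1 i)
    (hd : ∀ q : ℕ, q.Prime → (q:ℤ) ∣ y → q ∣ l) : False := by
  have hT := sol_T hl hb h
  have hi0 : i ≠ 0 := by rintro rfl; exact absurd hp (by decide)
  have hDT : (k:ℤ) * a^2 - 2 = l * b^2 + 2 := by linarith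
  rw [hDT] at hT hy
  set D : ℤ := l * b^2 with hD
  have hDodd : Odd D := by
    rw [hD, Int.odd_mul]
    refine ⟨by exact_mod_cast hol, Odd.pow ?_⟩
    rw [← Int.not_even_iff_odd]
    intro he
    have : 2 ∣ l := hd 2 Nat.prime_two (by rw [hy]; exact (he.two_dvd).mul_right _)
    obtain ⟨t, ht⟩ := hol
    omega
  have hbd := (g_r_bound (D+2) hT i).1
  have hG1 : 1 < g (D+2) 1 i := by omega
  have hdS : ∀ q : ℕ, q.Prime → (q:ℤ) ∣ g (D+2) 1 i → (q:ℤ) ∣ D := by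
    intro q hq hqG
    have : q ∣ l := hd q hq (by rw [hy]; exact hqG.mul_left _)
    exact Dvd.dvd.mul_right (by exact_mod_cast this) _
  obtain ⟨hpS, s, hs, hpow⟩ := prime_pow_of hp hG1
    (by
      obtain ⟨c, hc⟩ := (g_r_cong D i).1
      exact ⟨1, c, Or.inl rfl, by rw [hc]; push_cast; ring⟩) hdS
  by_cases h5 : 5 ≤ 2*i+1
  · have heq := eq_p_of hp h5 hs hpow hpS (by
      obtain ⟨c, hc⟩ := (g_r_cong2 D i).1
      refine ⟨1, c, (i*(i+1)), Or.inl rfl, ?_⟩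
      rw [hc]; push_cast; ring)
    rw [heq] at hbd
    push_cast at hbd
    omega
  · have hi1 : i = 1 := by omega
    subst hi1
    have e1 : g (D+2) 1 1 = D + 3 := by simp only [g]; ring
    rw [e1] at hpow
    have ho : Odd (((2*1+1:ℕ):ℤ)^s) := Odd.pow (by decide)
    rw [← hpow] at ho
    obtain ⟨r1, hr1⟩ := ho
    obtain ⟨r2, hr2⟩ := hDodd
    omega

lemma conclude {k l x y u v : ℕ} (hl : 0 < l) (hx : 0 < x) (hv : 0 < v)
    (h : (k:ℤ) * (x:ℤ)^2 - l * (y:ℤ)^2 = 4) (h' : (k:ℤ) * (u:ℤ)^2 - l * (v:ℤ)^2 = 4)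
    (hxu : x ≤ u) : (x : ℝ) * Real.sqrt k + (y : ℝ) * Real.sqrt l ≤
          (u : ℝ) * Real.sqrt k + (v : ℝ) * Real.sqrt l := by
  have hxu' : (x:ℤ) ≤ u := by exact_mod_cast hxu
  have := phi_le (k := k) (l := l) hxu' (y_le_of_x_le hl (by exact_mod_cast hx) (by exact_mod_cast hv) h h' hxu')
  unfold phi at this
  push_cast at this
  linarith

end StormerAux


/-- Luo's extension of Störmer's theorem for `k x² - l y² = 4` with `k, l` odd:
any positive integer solution whose `x` (resp. `y`) has all prime divisors
dividing `k` (resp. `l`) is the minimal positive solution, except for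
`(k, l, x, y) = (5, 1, 5, 11)` in the first case. -/
theorem stormer_kl_four (k l : ℕ) (hk : 1 < k) (hl : 0 < l)
    (hok : Odd k) (hol : Odd l)
    (hco : Nat.Coprime k l) (hns : ¬ IsSquare (k * l))
    (hsolvable : ∃ u v : ℕ, 0 < u ∧ 0 < v ∧ Odd u ∧ Odd v ∧
      (k : ℤ) * (u : ℤ) ^ 2 - (l : ℤ) * (v : ℤ) ^ 2 = 4)
    (x y : ℕ) (hx : 0 < x) (hy : 0 < y)
    (hsol : (k : ℤ) * (x : ℤ) ^ 2 - (l : ℤ) * (y : ℤ) ^ 2 = 4) :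
    ((∀ p : ℕ, p.Prime → p ∣ x → p ∣ k) →
      ¬ (k = 5 ∧ l = 1 ∧ x = 5 ∧ y = 11) →
      (∀ u v : ℕ, 0 < u → 0 < v →
        (k : ℤ) * (u : ℤ) ^ 2 - (l : ℤ) * (v : ℤ) ^ 2 = 4 →
        (x : ℝ) * Real.sqrt k + (y : ℝ) * Real.sqrt l ≤
          (u : ℝ) * Real.sqrt k + (v : ℝ) * Real.sqrt l)) ∧
    ((∀ p : ℕ, p.Prime → p ∣ y → p ∣ l) →
      (∀ u v : ℕ, 0 < u → 0 < v →
        (k : ℤ) * (u : ℤ) ^ 2 - (l : ℤ) * (v : ℤ) ^ 2 = 4 →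
        (x : ℝ) * Real.sqrt k + (y : ℝ) * Real.sqrt l ≤
          (u : ℝ) * Real.sqrt k + (v : ℝ) * Real.sqrt l)) := by


  constructor
  · intro hd hex u v hu hv huv
    by_cases hxu : x ≤ u
    · exact StormerAux.conclude hl hx hv hsol huv hxu
    exfalso
    obtain ⟨a, b, i, ha, hb, hab, hp, h1, h2⟩ := StormerAux.nonmin hk hl hok hol
      (by exact_mod_cast hx) (by exact_mod_cast hy) hsol
      (by exact_mod_cast hu) (by exact_mod_cast hv) huv (by omega)
    obtain ⟨e1, e2, e3, e4⟩ := StormerAux.part1 hok hl ha hb hab hp h1 h2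
      (fun q hq hqx => hd q hq (by exact_mod_cast hqx))
    exact hex ⟨e1, e2, by exact_mod_cast e3, by exact_mod_cast e4⟩
  · intro hd u v hu hv huv
    by_cases hxu : x ≤ u
    · exact StormerAux.conclude hl hx hv hsol huv hxu
    exfalso
    obtain ⟨a, b, i, ha, hb, hab, hp, h1, h2⟩ := StormerAux.nonmin hk hl hok hol
      (by exact_mod_cast hx) (by exact_mod_cast hy) hsol
      (by exact_mod_cast hu) (by exact_mod_cast hv) huv (by omega)
    exact StormerAux.part2 hol hl hb hab hp h2
      (fun q hq hqx => hd q hq (by exact_mod_cast hqx))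
end

section
/- Let D be a positive nonsquare integer and let (x, y) be a positive integer solution of x² − D y² = 1 with y = pⁿ y′, where p is a prime not dividing D and n is a positive integer. If every prime divisor of y′ divides D, then x + y√D = ε, or ε², or ε³, where ε = x₁ + y₁√D and (x₁, y₁) is the fundamental solution of x² − D y² = 1. -/
open Pell

/-- Lucas-type sequence attached to `x`. -/
def lucU (x : ℤ) : ℕ → ℤ
  | 0 => 0
  | 1 => 1
  | (n + 2) => 2 * x * lucU x (n + 1) - lucU x n

theorem lucU_add_two (x : ℤ) (n : ℕ) :
    lucU x (n + 2) = 2 * x * lucU x (n + 1) - lucU x n := rfl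

theorem lucU_pow {d : ℤ} (b : Solution₁ d) (n : ℕ) :
    (b ^ n).y = b.y * lucU b.x n ∧ (b ^ n).x = lucU b.x (n + 1) - b.x * lucU b.x n := by
  induction n with
  | zero => simp [lucU]
  | succ k ih =>
    obtain ⟨h1, h2⟩ := ih
    have hb := b.prop_y
    rw [pow_succ, Solution₁.y_mul, Solution₁.x_mul, h1, h2, lucU_add_two]
    constructor
    · ring
    · linear_combination lucU b.x k * hb

theorem lucU_inv (x : ℤ) (n : ℕ) :
    lucU x (n + 1) ^ 2 - 2 * x * lucU x (n + 1) * lucU x n + lucU x n ^ 2 = 1 := by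
  induction n with
  | zero => simp [lucU]
  | succ k ih => rw [lucU_add_two]; linear_combination ih

theorem lucU_double (x : ℤ) (r : ℕ) :
    lucU x (2 * r + 1) = lucU x (r + 1) ^ 2 - lucU x r ^ 2 ∧
    lucU x (2 * r + 2) = lucU x (r + 1) * (lucU x (r + 2) - lucU x r) := by
  induction r with
  | zero => simp [lucU]
  | succ k ih =>
    obtain ⟨h1, h2⟩ := ih
    have e1 : lucU x (2 * (k + 1) + 1) = 2 * x * lucU x (2 * k + 2) - lucU x (2 * k + 1) := rfl
    have e2 : lucU x (2 * (k + 1) + 2) =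
      2 * x * lucU x (2 * (k + 1) + 1) - lucU x (2 * k + 2) := rfl
    have e3 := lucU_add_two x k
    have e4 : lucU x (k + 1 + 2) = 2 * x * lucU x (k + 1 + 1) - lucU x (k + 1) := rfl
    have e5 : lucU x (k + 1 + 1) = 2 * x * lucU x (k + 1) - lucU x k := rfl
    constructor
    · rw [e1, h2, h1, e5]; ring
    · rw [e2, e1, h2, h1, e4, e5]; ring

theorem lucU_step (x : ℤ) (n : ℕ) :
    lucU x (n + 4) = (4 * x ^ 2 - 2) * lucU x (n + 2) - lucU x n := by
  have e1 : lucU x (n + 4) = 2 * x * lucU x (n + 3) - lucU x (n + 2) := rfl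
  have e2 : lucU x (n + 3) = 2 * x * lucU x (n + 2) - lucU x (n + 1) := rfl
  have e3 := lucU_add_two x n
  linear_combination e1 + 2 * x * e2 + e3

theorem lucU_mod (x : ℤ) (r : ℕ) :
    (∃ t, lucU x (2 * r + 1) = (2 * r + 1) + (x ^ 2 - 1) * t) ∧
    (∃ t, lucU x (2 * r + 3) = (2 * r + 3) + (x ^ 2 - 1) * t) := by
  induction r with
  | zero =>
    refine ⟨⟨0, by simp [lucU]⟩, ⟨4, by simp [lucU]; ring⟩⟩
  | succ k ih =>
    obtain ⟨⟨s, hs⟩, ⟨t, ht⟩⟩ := ih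
    have e : lucU x (2 * (k + 1) + 3) =
      (4 * x ^ 2 - 2) * lucU x (2 * k + 3) - lucU x (2 * k + 1) := lucU_step x (2 * k + 1)
    refine ⟨⟨t, ?_⟩, ⟨4 * (2 * k + 3) + (4 * x ^ 2 - 2) * t - s, ?_⟩⟩
    · have : 2 * (k + 1) + 1 = 2 * k + 3 := by ring
      rw [this, ht]; push_cast; ring
    · rw [e, hs, ht]; push_cast; ring

theorem lucU_mod2 (x : ℤ) (r : ℕ) :
    (∃ t, 6 * lucU x (2 * r + 1) =
      (2 * r + 1) * (6 + 4 * r * (r + 1) * (x ^ 2 - 1)) + (x ^ 2 - 1) ^ 2 * t) ∧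
    (∃ t, 6 * lucU x (2 * r + 3) =
      (2 * r + 3) * (6 + 4 * (r + 1) * (r + 2) * (x ^ 2 - 1)) + (x ^ 2 - 1) ^ 2 * t) := by
  induction r with
  | zero =>
    refine ⟨⟨0, by simp [lucU]⟩, ⟨0, by simp [lucU]; ring⟩⟩
  | succ k ih =>
    obtain ⟨⟨s, hs⟩, ⟨t, ht⟩⟩ := ih
    have e : lucU x (2 * (k + 1) + 3) =
      (4 * x ^ 2 - 2) * lucU x (2 * k + 3) - lucU x (2 * k + 1) := lucU_step x (2 * k + 1)
    refine ⟨⟨t, ?_⟩, ⟨16 * (2 * k + 3) * (k + 1) * (k + 2) + (4 * x ^ 2 - 2) * t - s, ?_⟩⟩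
    · have : 2 * (k + 1) + 1 = 2 * k + 3 := by ring
      rw [this, ht]; push_cast; ring
    · rw [e]; push_cast; linear_combination (4 * x ^ 2 - 2) * ht - hs

theorem lucU_growth {x : ℤ} (hx : 2 ≤ x) (n : ℕ) :
    (n : ℤ) ≤ lucU x n ∧ 3 * lucU x n + 1 ≤ lucU x (n + 1) := by
  induction n with
  | zero => simp [lucU]
  | succ k ih =>
    obtain ⟨h1, h2⟩ := ih
    have e5 : lucU x (k + 1 + 1) = 2 * x * lucU x (k + 1) - lucU x k := rfl
    have : (0 : ℤ) ≤ k := by positivity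
    constructor
    · push_cast; linarith
    · rw [e5]; nlinarith

/-- The key facts on odd-index terms. -/
theorem lucU_factor {x : ℤ} (hx : 2 ≤ x) (r : ℕ) (hr : 1 ≤ r) :
    ∃ P M : ℤ, lucU x (2 * r + 1) = P * M ∧ 1 < M ∧ 1 < P ∧
      (∀ l : ℕ, l.Prime → (l : ℤ) ∣ P → (l : ℤ) ∣ M → False) ∧
      (2 ≤ r → 2 * (r : ℤ) + 1 < M ∧ 2 * (r : ℤ) + 1 < P) := by
  obtain ⟨g1, g2⟩ := lucU_growth hx r
  have hr' : (1 : ℤ) ≤ r := by exact_mod_cast hr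
  refine ⟨lucU x (r + 1) + lucU x r, lucU x (r + 1) - lucU x r, ?_, by linarith, by linarith,
    ?_, ?_⟩
  · rw [(lucU_double x r).1]; ring
  · rintro l hl ⟨s, hs⟩ ⟨t, ht⟩
    have hI := lucU_inv x r
    have h2 : (l : ℤ) ^ 2 * (s ^ 2 * (1 - x) + t ^ 2 * (1 + x)) = 2 := by
      have : (l * s : ℤ) ^ 2 * (1 - x) + (l * t) ^ 2 * (1 + x) = 2 := by
        rw [← hs, ← ht]; linear_combination 2 * hI
      linear_combination this
    have h3 : (l : ℤ) ^ 2 ∣ 2 := ⟨_, h2.symm⟩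
    have h4 := Int.le_of_dvd (by norm_num) h3
    have : (2 : ℤ) ≤ l := by exact_mod_cast hl.two_le
    nlinarith
  · intro h
    obtain ⟨j, rfl⟩ := Nat.exists_eq_add_of_le' h
    obtain ⟨f1, f2⟩ := lucU_growth hx (j + 1)
    have e : lucU x (j + 2) = lucU x (j + 1 + 1) := rfl
    push_cast at *
    constructor <;> linarith

theorem exists_prime_dvd_int {c : ℤ} (hc : 1 < c) : ∃ l : ℕ, l.Prime ∧ (l : ℤ) ∣ c := by
  obtain ⟨l, hl, h⟩ := Nat.exists_prime_and_dvd (n := c.natAbs) (by omega)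
  exact ⟨l, hl, Int.natCast_dvd.2 h⟩

theorem prime_dvd_mod {d : ℤ} (b : Solution₁ d) (q r l : ℕ) (hq : q.Prime) (hqr : q = 2 * r + 1)
    (hl : l.Prime) (h : (l : ℤ) ∣ b.x ^ 2 - 1) (hU : (l : ℤ) ∣ lucU b.x q) : l = q := by
  subst hqr
  obtain ⟨t, ht⟩ := (lucU_mod b.x r).1
  have : (l : ℤ) ∣ 2 * r + 1 := by
    have h5 : (2 * r + 1 : ℤ) = lucU b.x (2 * r + 1) - (b.x ^ 2 - 1) * t := by rw [ht]; ring
    rw [h5]; exact dvd_sub hU (h.mul_right t)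
  have h6 : l ∣ 2 * r + 1 := by exact_mod_cast this
  exact (Nat.prime_dvd_prime_iff_eq hl hq).1 h6

theorem D_dvd_mod {d : ℤ} (b : Solution₁ d) {l : ℤ} (h : l ∣ d) : l ∣ b.x ^ 2 - 1 := by
  rw [← b.prop_y]; exact h.mul_right _

theorem y_dvd_mod {d : ℤ} (b : Solution₁ d) {l : ℤ} (h : l ∣ b.y) : l ∣ b.x ^ 2 - 1 := by
  rw [← b.prop_y]; exact (dvd_pow h two_ne_zero).mul_left _

theorem x_not_dvd {d : ℤ} (b : Solution₁ d) {l : ℕ} (hl : l.Prime) (hx : (l : ℤ) ∣ b.x)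
    (h : (l : ℤ) ∣ b.x ^ 2 - 1) : False := by
  have h1 : (l : ℤ) ∣ 1 := by
    have := dvd_sub (dvd_pow hx two_ne_zero) h
    simpa using this
  have := Int.le_of_dvd one_pos h1
  have : (2 : ℤ) ≤ l := by exact_mod_cast hl.two_le
  omega

theorem one_lt_x_pow {d : ℤ} (hd : 0 < d) {a : Solution₁ d} (hx : 0 < a.x) (hy : 0 < a.y)
    (k : ℕ) (hk : k ≠ 0) : 2 ≤ (a ^ k).x := by
  have h1 := Solution₁.x_pow_pos hx k
  obtain ⟨j, rfl⟩ := Nat.exists_eq_succ_of_ne_zero hk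
  have h2 := Solution₁.y_pow_succ_pos hx hy j
  have h3 := (a ^ (j.succ)).prop_y
  have h4 : 0 < d * (a ^ j.succ).y ^ 2 := by positivity
  nlinarith

theorem y_double {d : ℤ} (b : Solution₁ d) : (b ^ 2).y = 2 * b.x * b.y := by
  rw [pow_two, Solution₁.y_mul]; ring

/-- Størmer's theorem. -/
theorem stormer_classic {d : ℤ} (hd : 0 < d) (a : Solution₁ d) (hx : 0 < a.x) (hy : 0 < a.y)
    (m : ℕ) (hm : m ≠ 0) (H : ∀ l : ℕ, l.Prime → (l : ℤ) ∣ (a ^ m).y → (l : ℤ) ∣ d) : m = 1 := by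
  by_contra hm1
  obtain ⟨q, hq, k, rfl⟩ := Nat.exists_prime_and_dvd hm1
  have hk : k ≠ 0 := by rintro rfl; simp at hm
  rw [mul_comm, pow_mul] at H
  have hb := one_lt_x_pow hd hx hy k hk
  generalize a ^ k = b at *
  rcases hq.eq_two_or_odd' with rfl | ⟨r, hr⟩
  · rw [y_double] at H
    obtain ⟨l, hl, hlx⟩ := exists_prime_dvd_int (c := b.x) (by omega)
    exact x_not_dvd b hl hlx (D_dvd_mod b (H l hl ((hlx.mul_left 2).mul_right _)))
  · have hr1 : 1 ≤ r := by have := hq.two_le; omega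
    obtain ⟨P, M, hPM, hM, hP, hcop, -⟩ := lucU_factor hb r hr1
    rw [← hr] at hPM
    have key : ∀ l : ℕ, l.Prime → (l : ℤ) ∣ P * M → l = q := by
      intro l hl h
      rw [← hPM] at h
      refine prime_dvd_mod b q r l hq hr hl (D_dvd_mod b (H l hl ?_)) h
      rw [(lucU_pow b q).1]; exact h.mul_left _
    obtain ⟨l, hl, h1⟩ := exists_prime_dvd_int hP
    obtain ⟨l', hl', h2⟩ := exists_prime_dvd_int hM
    have e1 := key l hl (h1.mul_right _)
    have e2 := key l' hl' (h2.mul_left _)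
    subst e1 e2
    exact hcop _ hl h1 h2

theorem eq_prime_of {q : ℕ} {V : ℤ} (hV : 1 < V)
    (h : ∀ l : ℕ, l.Prime → (l : ℤ) ∣ V → l = q) (h2 : ¬ (q : ℤ) ^ 2 ∣ V) : V = q := by
  obtain ⟨l, hl, hlV⟩ := exists_prime_dvd_int hV
  have := h l hl hlV
  subst this
  obtain ⟨c, rfl⟩ := hlV
  have hl0 : (0 : ℤ) < l := by exact_mod_cast hl.pos
  have hc : 0 < c := by
    by_contra hc
    nlinarith
  rcases (show 1 ≤ c by omega).eq_or_lt with rfl | hc1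
  · simp
  · exfalso
    obtain ⟨l', hl', h'⟩ := exists_prime_dvd_int hc1
    have := h l' hl' (h'.mul_left _)
    subst this
    exact h2 (by rw [pow_two]; exact mul_dvd_mul_left _ h')

theorem sq_not_dvd {x : ℤ} (q r : ℕ) (hq : q.Prime) (hqr : q = 2 * r + 1) (hr : 2 ≤ r)
    (h : (q : ℤ) ∣ x ^ 2 - 1) : ¬ (q : ℤ) ^ 2 ∣ lucU x q := by
  rintro ⟨c, hc⟩
  obtain ⟨t, ht⟩ := (lucU_mod2 x r).1
  rw [← hqr, hc] at ht
  obtain ⟨s, hs⟩ := h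
  have hq' : (2 * r + 1 : ℤ) = q := by rw [hqr]; push_cast; ring
  rw [hq', hs] at ht
  have hq0 : (q : ℤ) ≠ 0 := by exact_mod_cast hq.ne_zero
  have h6 : (q : ℤ) * (q * (6 * c - 4 * r * (r + 1) * s - s ^ 2 * t)) = q * 6 := by
    linear_combination ht
  have h7 := mul_left_cancel₀ hq0 h6
  have h8 : q ∣ 6 := by
    have : (q : ℤ) ∣ 6 := ⟨_, h7.symm⟩
    exact_mod_cast this
  have h9 := Nat.le_of_dvd (by norm_num) h8
  have : q = 5 := by omega
  subst this
  omega

theorem stormer_core {d : ℤ} (hd : 0 < d) (a : Solution₁ d) (hx : 0 < a.x) (hy : 0 < a.y)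
    (m : ℕ) (hm : m ≠ 0) (p : ℕ)
    (H : ∀ l : ℕ, l.Prime → (l : ℤ) ∣ (a ^ m).y → l = p ∨ (l : ℤ) ∣ d) :
    m = 1 ∨ m = 2 ∨ m = 3 := by
  by_cases hm1 : m = 1
  · exact Or.inl hm1
  obtain ⟨q, hq, k, rfl⟩ := Nat.exists_prime_and_dvd hm1
  have hk : k ≠ 0 := by rintro rfl; simp at hm
  rw [mul_comm, pow_mul] at H
  have hb := one_lt_x_pow hd hx hy k hk
  have hS := stormer_classic hd a hx hy k hk
  generalize a ^ k = b at *
  rcases hq.eq_two_or_odd' with rfl | ⟨r, hr⟩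
  · rw [y_double] at H
    obtain ⟨l, hl, hlx⟩ := exists_prime_dvd_int (c := b.x) (by omega)
    rcases H l hl ((hlx.mul_left 2).mul_right _) with rfl | h
    · have : k = 1 := by
        refine hS fun l' hl' h' => ?_
        rcases H l' hl' (h'.mul_left _) with rfl | h
        · exact (x_not_dvd b hl hlx (y_dvd_mod b h')).elim
        · exact h
      subst this; simp
    · exact (x_not_dvd b hl hlx (D_dvd_mod b h)).elim
  · have hr1 : 1 ≤ r := by have := hq.two_le; omega
    obtain ⟨P, M, hPM, hM, hP, hcop, hgrow⟩ := lucU_factor hb r hr1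
    rw [← hr] at hPM
    have hy' := (lucU_pow b q).1
    have key : ∀ l : ℕ, l.Prime → (l : ℤ) ∣ P * M → l = p ∨ (l = q ∧ (q : ℤ) ∣ d) := by
      intro l hl h
      rw [← hPM] at h
      rcases H l hl (by rw [hy']; exact h.mul_left _) with h1 | h1
      · exact Or.inl h1
      · have := prime_dvd_mod b q r l hq hr hl (D_dvd_mod b h1) h
        subst this
        exact Or.inr ⟨rfl, h1⟩
    -- main symmetric argument
    have main : ∀ P M : ℤ, lucU b.x q = P * M → 1 < M → 1 < P →
        (∀ l : ℕ, l.Prime → (l : ℤ) ∣ P → (l : ℤ) ∣ M → False) →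
        (2 ≤ r → 2 * (r : ℤ) + 1 < M) →
        (∀ l : ℕ, l.Prime → (l : ℤ) ∣ P * M → l = p ∨ (l = q ∧ (q : ℤ) ∣ d)) →
        (p.Prime ∧ (p : ℤ) ∣ P) → q = 3 ∧ k = 1 := by
      rintro P M hPM hM hP hcop hgrow key ⟨hp, hpP⟩
      have hMq : ∀ l : ℕ, l.Prime → (l : ℤ) ∣ M → l = q ∧ (q : ℤ) ∣ d := by
        intro l hl h
        rcases key l hl (h.mul_left _) with rfl | h1
        · exact (hcop _ hl hpP h).elim
        · exact h1
      obtain ⟨l, hl, hlM⟩ := exists_prime_dvd_int hM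
      obtain ⟨rfl, hqd⟩ := hMq l hl hlM
      have hr2 : ¬ 2 ≤ r := by
        intro h2
        have hs := sq_not_dvd l r hq hr h2 (D_dvd_mod b hqd)
        have := eq_prime_of hM (fun l hl h => (hMq l hl h).1)
          (fun h => hs (by rw [hPM]; exact h.mul_left _))
        have h3 := hgrow h2
        rw [this, hr] at h3
        push_cast at h3
        omega
      have hq3 : l = 3 := by omega
      refine ⟨hq3, hS fun l' hl' h' => ?_⟩
      rcases H l' hl' (by rw [hy']; exact h'.mul_right _) with rfl | h
      · have := prime_dvd_mod b l r l' hq hr hl' (y_dvd_mod b h')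
          (by rw [hPM]; exact hpP.mul_right _)
        rw [this]; exact hqd
      · exact h
    have fin : q = 3 ∧ k = 1 := by
      obtain ⟨l, hl, h1⟩ := exists_prime_dvd_int hP
      obtain ⟨l', hl', h2⟩ := exists_prime_dvd_int hM
      rcases key l hl (h1.mul_right _) with rfl | ⟨rfl, -⟩
      · exact main P M hPM hM hP hcop (fun h => (hgrow h).1) key ⟨hl, h1⟩
      · rcases key l' hl' (h2.mul_left _) with rfl | ⟨rfl, -⟩
        · exact main M P (by rw [hPM, mul_comm]) hP hM (fun l hl a b => hcop l hl b a)
            (fun h => (hgrow h).2) (by rwa [mul_comm]) ⟨hl', h2⟩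
        · exact (hcop _ hl h1 h2).elim
    obtain ⟨rfl, rfl⟩ := fin
    simp

/-- Mei–Mei–Fan–Song extension of Störmer's theorem: a positive solution of
`x² - D y² = 1` with `y = pⁿ y'`, `p` a prime not dividing `D`, and every prime
divisor of `y'` dividing `D`, is `ε`, `ε²` or `ε³` where `ε` corresponds to the
fundamental solution. -/
theorem stormer_one_prime (D : ℤ) (hD : 0 < D) (hns : ¬ IsSquare D)
    (x₁ y₁ : ℤ) (hx₁ : 0 < x₁) (hy₁ : 0 < y₁)
    (hsol₁ : x₁ ^ 2 - D * y₁ ^ 2 = 1)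
    (hmin : ∀ u v : ℤ, 0 < u → 0 < v → u ^ 2 - D * v ^ 2 = 1 →
      (x₁ : ℝ) + (y₁ : ℝ) * Real.sqrt (D : ℝ) ≤ (u : ℝ) + (v : ℝ) * Real.sqrt (D : ℝ))
    (x y : ℤ) (hx : 0 < x) (hy : 0 < y)
    (hsol : x ^ 2 - D * y ^ 2 = 1)
    (p : ℕ) (hp : p.Prime) (hpD : ¬ (p : ℤ) ∣ D)
    (n : ℕ) (hn : 0 < n) (y' : ℤ) (hyy : y = (p : ℤ) ^ n * y')
    (hdiv : ∀ q : ℕ, q.Prime → (q : ℤ) ∣ y' → (q : ℤ) ∣ D) :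
    ∃ m : ℕ, (m = 1 ∨ m = 2 ∨ m = 3) ∧
      (x : ℝ) + (y : ℝ) * Real.sqrt (D : ℝ) =
        ((x₁ : ℝ) + (y₁ : ℝ) * Real.sqrt (D : ℝ)) ^ m := by

  have hx1 : 1 < x₁ := by
    have : 0 < D * y₁ ^ 2 := by positivity
    nlinarith
  have hfund : IsFundamental (Solution₁.mk x₁ y₁ hsol₁) := by
    refine ⟨by simpa using hx1, by simpa using hy₁, ?_⟩
    intro b hb
    rw [Solution₁.x_mk]
    by_contra hlt
    push Not at hlt
    have hby := Solution₁.y_ne_zero_of_one_lt_x hb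
    have h1 := hmin b.x |b.y| (by omega) (abs_pos.2 hby) (by rw [sq_abs]; exact b.prop)
    have h2 : |b.y| < y₁ := by
      apply abs_lt_of_sq_lt_sq _ hy₁.le
      have := b.prop_y
      have h3 : D * b.y ^ 2 < D * y₁ ^ 2 := by nlinarith
      exact lt_of_mul_lt_mul_left h3 hD.le
    have h3 : (b.x : ℝ) < x₁ := by exact_mod_cast hlt
    have h4 : ((|b.y| : ℤ) : ℝ) ≤ y₁ := by exact_mod_cast h2.le
    have h5 := mul_le_mul_of_nonneg_right h4 (Real.sqrt_nonneg (D : ℝ))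
    linarith
  obtain ⟨m, hm⟩ := hfund.eq_pow_of_nonneg (a := Solution₁.mk x y hsol) (by simpa using hx)
    (by simpa using hy.le)
  have hmy := congrArg Solution₁.y hm
  have hmx := congrArg Solution₁.x hm
  rw [Solution₁.y_mk] at hmy
  rw [Solution₁.x_mk] at hmx
  have hm0 : m ≠ 0 := by
    rintro rfl
    simp at hmy
    omega
  have hmm := stormer_core hD (Solution₁.mk x₁ y₁ hsol₁) (by simpa using hx₁) (by simpa using hy₁)
    m hm0 p (by
      intro l hl h
      rw [← hmy, hyy] at h
      rcases (Nat.prime_iff_prime_int.1 hl).dvd_or_dvd h with h | h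
      · left
        have h1 := (Nat.prime_iff_prime_int.1 hl).dvd_of_dvd_pow h
        exact (Nat.prime_dvd_prime_iff_eq hl hp).1 (by exact_mod_cast h1)
      · exact Or.inr (hdiv l hl h))
  have hs : Real.sqrt (D : ℝ) ^ 2 = D := Real.sq_sqrt (by exact_mod_cast hD.le)
  refine ⟨m, hmm, ?_⟩
  clear hm hmm hm0 hyy hsol hx hy
  have gen : ∀ k : ℕ, ((Solution₁.mk x₁ y₁ hsol₁ ^ k).x : ℝ) +
      ((Solution₁.mk x₁ y₁ hsol₁ ^ k).y : ℝ) * Real.sqrt (D : ℝ) =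
      ((x₁ : ℝ) + (y₁ : ℝ) * Real.sqrt (D : ℝ)) ^ k := by
    intro k
    induction k with
    | zero => simp
    | succ k ih =>
      rw [pow_succ (_ + _), ← ih, pow_succ, Solution₁.x_mul, Solution₁.y_mul,
        Solution₁.x_mk, Solution₁.y_mk]
      push_cast
      linear_combination (-((Solution₁.mk x₁ y₁ hsol₁ ^ k).y : ℝ) * y₁) * hs
  rw [hmx, hmy]
  exact gen m
end
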